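/- arXiv:1812.01927 — 4 statements merged into one kernel-verified Lean document; each statement's English description precedes it below -/
import Mathlib

section
/- Fix m ≥ 1 and 0 ≤ r ≤ m-1. Let S be the set of even permutations π of [2m+1] with π(2r+2) = 2m+1 whose restriction to [2m] (deleting the letter 2m+1) is an odd permutation of [2m], and let T be the set of odd permutations π of [2m+1] with π(2m-2r) = 2m+1 whose restriction to [2m] is an even permutation. Then Σ_{π ∈ S} t^{des(π)} s^{asc(π)} = Σ_{π ∈ T} t^{des(π)} s^{asc(π)}. -/
open Finset

/-- number of descents of a permutation of `Fin n` (one-line notation). -/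
def desA {n : ℕ} (π : Equiv.Perm (Fin n)) : ℕ :=
  (Finset.univ.filter (fun i : Fin (n-1) =>
    π ⟨i.1+1, by have := i.2; omega⟩ < π ⟨i.1, by have := i.2; omega⟩)).card

/-- number of ascents. -/
def ascA {n : ℕ} (π : Equiv.Perm (Fin n)) : ℕ :=
  (Finset.univ.filter (fun i : Fin (n-1) =>
    π ⟨i.1, by have := i.2; omega⟩ < π ⟨i.1+1, by have := i.2; omega⟩)).card

/-- number of inversions. -/
def invA {n : ℕ} (π : Equiv.Perm (Fin n)) : ℕ :=
  (Finset.univ.filter (fun p : Fin n × Fin n => p.1 < p.2 ∧ π p.2 < π p.1)).card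

/-- bivariate Eulerian polynomial over all of `S_n`; variable 0 is `s`, variable 1 is `t`. -/
noncomputable def Abiv (n : ℕ) : MvPolynomial (Fin 2) ℚ :=
  ∑ π : Equiv.Perm (Fin n), MvPolynomial.X 1 ^ desA π * MvPolynomial.X 0 ^ ascA π

noncomputable def AbivP (n : ℕ) : MvPolynomial (Fin 2) ℚ :=
  ∑ π ∈ Finset.univ.filter (fun π : Equiv.Perm (Fin n) => Equiv.Perm.sign π = 1),
    MvPolynomial.X 1 ^ desA π * MvPolynomial.X 0 ^ ascA π

noncomputable def AbivM (n : ℕ) : MvPolynomial (Fin 2) ℚ :=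
  ∑ π ∈ Finset.univ.filter (fun π : Equiv.Perm (Fin n) => Equiv.Perm.sign π = -1),
    MvPolynomial.X 1 ^ desA π * MvPolynomial.X 0 ^ ascA π

noncomputable def Auni (n : ℕ) : Polynomial ℚ :=
  ∑ π : Equiv.Perm (Fin n), Polynomial.X ^ desA π

noncomputable def AuniP (n : ℕ) : Polynomial ℚ :=
  ∑ π ∈ Finset.univ.filter (fun π : Equiv.Perm (Fin n) => Equiv.Perm.sign π = 1),
    Polynomial.X ^ desA π

noncomputable def AuniM (n : ℕ) : Polynomial ℚ :=
  ∑ π ∈ Finset.univ.filter (fun π : Equiv.Perm (Fin n) => Equiv.Perm.sign π = -1),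
    Polynomial.X ^ desA π

/-- the operator `∂/∂s + ∂/∂t`. -/
noncomputable def Dop (f : MvPolynomial (Fin 2) ℚ) : MvPolynomial (Fin 2) ℚ :=
  MvPolynomial.pderiv 0 f + MvPolynomial.pderiv 1 f

/-- A univariate polynomial is palindromic: with `r` the least exponent with nonzero
coefficient and `n` the degree, `a_{r+i} = a_{n-i}`. -/
def Palind (f : Polynomial ℚ) : Prop :=
  ∀ i ≤ f.natDegree - f.natTrailingDegree,
    f.coeff (f.natTrailingDegree + i) = f.coeff (f.natDegree - i)

/-- bivariate gamma positivity with center of symmetry `N/2`. -/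
def BivGamma (f : MvPolynomial (Fin 2) ℚ) (N : ℕ) : Prop :=
  ∃ γ : ℕ → ℕ, (∀ i, γ i ≠ 0 → 2*i ≤ N) ∧
    f = ∑ i ∈ Finset.range (N+1), (γ i : MvPolynomial (Fin 2) ℚ) *
      ((MvPolynomial.X 0 * MvPolynomial.X 1)^i * (MvPolynomial.X 0 + MvPolynomial.X 1)^(N - 2*i))

/-- univariate gamma positivity with center of symmetry `c2/2`. -/
def UniGamma (f : Polynomial ℚ) (c2 : ℕ) : Prop :=
  ∃ γ : ℕ → ℕ, (∀ i, γ i ≠ 0 → 2*i ≤ c2) ∧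
    f = ∑ i ∈ Finset.range (c2+1), (γ i : ℚ) •
      (Polynomial.X^i * (1 + Polynomial.X)^(c2 - 2*i))

/-- signed permutations: a permutation together with a sign for each position. -/
abbrev SignedPerm (n : ℕ) := Equiv.Perm (Fin n) × (Fin n → Bool)

/-- the one-line word of a signed permutation, 1-indexed, with `bw w 0 = 0`;
entry `i` is `±(w.1 i + 1)` viewed in `{-n,…,-1,1,…,n}`. -/
def bw {n : ℕ} (w : SignedPerm n) (i : ℕ) : ℤ :=
  if h : 1 ≤ i ∧ i ≤ n then
    (if w.2 ⟨i-1, by omega⟩ then -(((w.1 ⟨i-1, by omega⟩ : ℕ) : ℤ) + 1)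
     else ((w.1 ⟨i-1, by omega⟩ : ℕ) : ℤ) + 1)
  else 0

/-- type-B descents (including a possible descent at position 0). -/
def desB {n : ℕ} (w : SignedPerm n) : ℕ :=
  ((Finset.range n).filter (fun i => bw w (i+1) < bw w i)).card

/-- type-B inversions (length). -/
def invB {n : ℕ} (w : SignedPerm n) : ℕ :=
  (Finset.univ.filter (fun p : Fin n × Fin n => p.1 < p.2 ∧ bw w (p.2.1+1) < bw w (p.1.1+1))).card
  + (Finset.univ.filter (fun p : Fin n × Fin n => p.1 < p.2 ∧ bw w (p.2.1+1) < -(bw w (p.1.1+1)))).card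
  + (Finset.univ.filter (fun i : Fin n => bw w (i.1+1) < 0)).card

/-- type-D inversions. -/
def invD {n : ℕ} (w : SignedPerm n) : ℕ :=
  (Finset.univ.filter (fun p : Fin n × Fin n => p.1 < p.2 ∧ bw w (p.2.1+1) < bw w (p.1.1+1))).card
  + (Finset.univ.filter (fun p : Fin n × Fin n => p.1 < p.2 ∧ bw w (p.2.1+1) < -(bw w (p.1.1+1)))).card

noncomputable def Bbiv (n : ℕ) : MvPolynomial (Fin 2) ℚ :=
  ∑ w : SignedPerm n, MvPolynomial.X 1 ^ desB w * MvPolynomial.X 0 ^ (n - desB w)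

noncomputable def BbivP (n : ℕ) : MvPolynomial (Fin 2) ℚ :=
  ∑ w ∈ Finset.univ.filter (fun w : SignedPerm n => Even (invB w)),
    MvPolynomial.X 1 ^ desB w * MvPolynomial.X 0 ^ (n - desB w)

noncomputable def BbivM (n : ℕ) : MvPolynomial (Fin 2) ℚ :=
  ∑ w ∈ Finset.univ.filter (fun w : SignedPerm n => ¬ Even (invB w)),
    MvPolynomial.X 1 ^ desB w * MvPolynomial.X 0 ^ (n - desB w)

noncomputable def BuniP (n : ℕ) : Polynomial ℚ :=
  ∑ w ∈ Finset.univ.filter (fun w : SignedPerm n => Even (invB w)), Polynomial.X ^ desB w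

noncomputable def BuniM (n : ℕ) : Polynomial ℚ :=
  ∑ w ∈ Finset.univ.filter (fun w : SignedPerm n => ¬ Even (invB w)), Polynomial.X ^ desB w

/-- deleting the largest letter from the one-line notation of `π ∈ S_{n+1}`
gives a permutation of `[n]`. -/
noncomputable def restrictMax {n : ℕ} (π : Equiv.Perm (Fin (n+1))) : Equiv.Perm (Fin n) :=
  Equiv.ofBijective
    (fun i => Fin.castPred (π ((π.symm (Fin.last n)).succAbove i))
      (by
        intro h
        have h2 : (π.symm (Fin.last n)).succAbove i = π.symm (Fin.last n) := by
          apply π.injective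
          rw [h, Equiv.apply_symm_apply]
        exact Fin.succAbove_ne _ i h2))
    (Finite.injective_iff_bijective.mp (by
      intro i j h
      have h2 : π ((π.symm (Fin.last n)).succAbove i) = π ((π.symm (Fin.last n)).succAbove j) :=
        Fin.castPred_inj.mp h
      have h3 := π.injective h2
      exact Fin.succAbove_right_injective h3))

/-- number of even permutations of `[n]` with `k` descents (`k : ℤ`). -/
noncomputable def aP (n : ℕ) (k : ℤ) : ℕ :=
  (Finset.univ.filter (fun π : Equiv.Perm (Fin n) =>
    Equiv.Perm.sign π = 1 ∧ (desA π : ℤ) = k)).card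

/-- number of odd permutations of `[n]` with `k` descents. -/
noncomputable def aM (n : ℕ) (k : ℤ) : ℕ :=
  (Finset.univ.filter (fun π : Equiv.Perm (Fin n) =>
    Equiv.Perm.sign π = -1 ∧ (desA π : ℤ) = k)).card
lemma castSucc_restrictMax {n : ℕ} (π : Equiv.Perm (Fin (n + 1))) (i : Fin n) :
    (restrictMax π i).castSucc = π ((π.symm (Fin.last n)).succAbove i) := by
  simp [restrictMax]

/-- Relabelling the letters by a permutation that fixes the largest one commutes with
`restrictMax`. -/
lemma restrictMax_mul {n : ℕ} (σ π : Equiv.Perm (Fin (n + 1))) (τ : Equiv.Perm (Fin n))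
    (hlast : σ (Fin.last n) = Fin.last n) (h : ∀ i, σ (Fin.castSucc i) = Fin.castSucc (τ i)) :
    restrictMax (σ * π) = τ * restrictMax π := by
  ext i : 1
  apply Fin.castSucc_injective
  have hsymm : (σ * π).symm (Fin.last n) = π.symm (Fin.last n) := by
    rw [Equiv.symm_apply_eq, Equiv.Perm.mul_apply, Equiv.apply_symm_apply, hlast]
  rw [castSucc_restrictMax, hsymm, Equiv.Perm.mul_apply, Equiv.Perm.mul_apply,
    ← castSucc_restrictMax, h]

lemma restrictMax_mul_revPerm {n : ℕ} (π : Equiv.Perm (Fin (n + 1))) :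
    restrictMax (π * Fin.revPerm) = restrictMax π * Fin.revPerm := by
  ext i : 1
  apply Fin.castSucc_injective
  have hsymm : (π * Fin.revPerm).symm (Fin.last n) = (π.symm (Fin.last n)).rev := by
    rw [Equiv.symm_apply_eq]
    simp
  rw [castSucc_restrictMax, hsymm, Equiv.Perm.mul_apply, Equiv.Perm.mul_apply,
    castSucc_restrictMax, Fin.revPerm_apply, Fin.revPerm_apply, Fin.rev_succAbove, Fin.rev_rev]

lemma ascent_iff_not_descent {n : ℕ} (π : Equiv.Perm (Fin n)) {i : ℕ} (hi : i < n)
    (hi' : i + 1 < n) : π ⟨i, hi⟩ < π ⟨i + 1, hi'⟩ ↔ ¬ π ⟨i + 1, hi'⟩ < π ⟨i, hi⟩ := by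
  have hne : π ⟨i, hi⟩ ≠ π ⟨i + 1, hi'⟩ := by simp [π.injective.eq_iff]
  exact ⟨fun h => h.not_gt, fun h => lt_of_le_of_ne (le_of_not_gt h) hne⟩

lemma desA_eq_and_ascA_eq {n : ℕ} {π ρ : Equiv.Perm (Fin n)} (e : Equiv.Perm (Fin (n - 1)))
    (h : ∀ i j : Fin (n - 1), e i = j →
      (π ⟨i.1 + 1, by omega⟩ < π ⟨i.1, by omega⟩ ↔
        ρ ⟨j.1 + 1, by omega⟩ < ρ ⟨j.1, by omega⟩)) :
    desA π = desA ρ ∧ ascA π = ascA ρ := by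
  refine ⟨Finset.card_equiv e fun i => ?_, Finset.card_equiv e fun i => ?_⟩
  · simpa using h i _ rfl
  · simp only [Finset.mem_filter, Finset.mem_univ, true_and]
    rw [ascent_iff_not_descent, ascent_iff_not_descent, h i _ rfl]

/-- The complement `x ↦ n - 1 - x` of the letters below the largest letter `n`, which is fixed. -/
def complementBelowLast (n : ℕ) : Equiv.Perm (Fin (n + 1)) :=
  Fin.revPerm * finRotate (n + 1)

lemma complementBelowLast_last (n : ℕ) :
    complementBelowLast n (Fin.last n) = Fin.last n := by
  simp [complementBelowLast]

lemma complementBelowLast_castSucc {n : ℕ} (i : Fin n) :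
    complementBelowLast n i.castSucc = (Fin.revPerm i).castSucc := by
  rw [complementBelowLast, Equiv.Perm.mul_apply]
  have : finRotate (n + 1) i.castSucc = i.succ := by
    ext
    simp
  rw [this]
  simp [Fin.rev_succ]

lemma complementBelowLast_lt_iff {n : ℕ} {x y : Fin (n + 1)}
    (hx : x ≠ Fin.last n) (hy : y ≠ Fin.last n) :
    complementBelowLast n x < complementBelowLast n y ↔ y < x := by
  obtain ⟨x, rfl⟩ := Fin.exists_castSucc_eq.mpr hx
  obtain ⟨y, rfl⟩ := Fin.exists_castSucc_eq.mpr hy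
  simp [complementBelowLast_castSucc]

lemma complementBelowLast_eq_last_iff {n : ℕ} {x : Fin (n + 1)} :
    complementBelowLast n x = Fin.last n ↔ x = Fin.last n := by
  rw [← (complementBelowLast n).injective.eq_iff (a := x), complementBelowLast_last]

/-- Reverse the word and complement all its letters except the largest. -/
def reverseComplement (n : ℕ) : Equiv.Perm (Fin (n + 1)) ≃ Equiv.Perm (Fin (n + 1)) :=
  (Equiv.mulLeft (complementBelowLast n)).trans (Equiv.mulRight Fin.revPerm)

lemma reverseComplement_eq {n : ℕ} (π : Equiv.Perm (Fin (n + 1))) :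
    reverseComplement n π = complementBelowLast n * π * Fin.revPerm := rfl

lemma reverseComplement_apply {n : ℕ} (π : Equiv.Perm (Fin (n + 1))) (i : Fin (n + 1)) :
    reverseComplement n π i = complementBelowLast n (π i.rev) := rfl

lemma sign_reverseComplement {n : ℕ} (hn : Even n) (π : Equiv.Perm (Fin (n + 1))) :
    Equiv.Perm.sign (reverseComplement n π) = Equiv.Perm.sign π := by
  rw [reverseComplement_eq, complementBelowLast]
  simp only [map_mul, sign_finRotate, Nat.add_sub_cancel, hn.neg_one_pow, mul_one]
  rw [mul_right_comm, Int.units_mul_self, one_mul]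

lemma sign_restrictMax_reverseComplement {n : ℕ} (π : Equiv.Perm (Fin (n + 1))) :
    Equiv.Perm.sign (restrictMax (reverseComplement n π)) =
      Equiv.Perm.sign (restrictMax π) := by
  rw [reverseComplement_eq, restrictMax_mul_revPerm,
    restrictMax_mul _ _ Fin.revPerm (complementBelowLast_last n) complementBelowLast_castSucc]
  simp only [map_mul]
  rw [mul_right_comm, Int.units_mul_self, one_mul]

lemma desA_ascA_reverseComplement {n : ℕ} (π : Equiv.Perm (Fin (n + 1))) (p : ℕ) (hp : 0 < p)
    (hpn : p < n) (hπ : π ⟨p, by omega⟩ = Fin.last n) :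
    desA (reverseComplement n π) = desA π ∧ ascA (reverseComplement n π) = ascA π := by
  have eq_last_iff (j : Fin (n + 1)) : π j = Fin.last n ↔ j.1 = p := by
    rw [← hπ, π.injective.eq_iff, Fin.ext_iff]
  refine desA_eq_and_ascA_eq (n := n + 1)
    (Fin.revPerm.trans (Equiv.swap ⟨p - 1, by omega⟩ ⟨p, by omega⟩)) fun i j hj => ?_
  have hi : i.1 < n := i.2
  have hrev₀ : Fin.rev (⟨i.1, by omega⟩ : Fin (n + 1)) = ⟨n - 1 - i.1 + 1, by omega⟩ := by
    ext; simp only [Fin.val_rev]; omega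
  have hrev₁ : Fin.rev (⟨i.1 + 1, by omega⟩ : Fin (n + 1)) = ⟨n - 1 - i.1, by omega⟩ := by
    ext; simp only [Fin.val_rev]; omega
  have hrev : Fin.revPerm i = ⟨n - 1 - i.1, by omega⟩ := by
    ext; simp only [Fin.revPerm_apply, Fin.val_rev]; omega
  rw [reverseComplement_apply, reverseComplement_apply, hrev₀, hrev₁]
  rw [Equiv.trans_apply, hrev] at hj
  by_cases h₁ : n - 1 - i.1 = p - 1
  · have hjp : j.1 = p := by
      simp only [h₁, Equiv.swap_apply_left] at hj
      exact (congrArg Fin.val hj).symm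
    have hleft : π ⟨n - 1 - i.1 + 1, by omega⟩ = Fin.last n := by
      rw [eq_last_iff]; simp only; omega
    have hright : π ⟨j.1, by omega⟩ = Fin.last n := by
      rw [eq_last_iff]; exact hjp
    rw [hleft, hright, complementBelowLast_last, Fin.lt_last_iff_ne_last,
      Fin.lt_last_iff_ne_last, Ne, Ne, complementBelowLast_eq_last_iff, eq_last_iff, eq_last_iff]
    simp only
    omega
  by_cases h₂ : n - 1 - i.1 = p
  · have hjp : j.1 = p - 1 := by
      simp only [h₂, Equiv.swap_apply_right] at hj
      exact (congrArg Fin.val hj).symm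
    have hleft : π ⟨n - 1 - i.1, by omega⟩ = Fin.last n := by
      rw [eq_last_iff]; exact h₂
    have hright : π ⟨j.1 + 1, by omega⟩ = Fin.last n := by
      rw [eq_last_iff]; simp only; omega
    rw [hleft, hright, complementBelowLast_last]
    simp only [(Fin.le_last _).not_gt]
  · rw [Equiv.swap_apply_of_ne_of_ne (by simpa [Fin.ext_iff] using h₁)
      (by simpa [Fin.ext_iff] using h₂)] at hj
    have hjv : n - 1 - i.1 = j.1 := congrArg Fin.val hj
    simp only [hjv]
    apply complementBelowLast_lt_iff
    · rw [Ne, eq_last_iff]; simp only; omega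
    · rw [Ne, eq_last_iff]; simp only; omega

/-- The letter `j` stands to the left of the largest letter. -/
def LeftOfMax {n : ℕ} (π : Equiv.Perm (Fin (n + 1))) (j : Fin n) : Prop :=
  π.symm j.castSucc < π.symm (Fin.last n)

/-- The transposition of the letters `2 * k` and `2 * k + 1`. -/
def pairSwap {m : ℕ} (k : Fin m) : Equiv.Perm (Fin (2 * m)) :=
  Equiv.swap ⟨2 * k.1, by omega⟩ ⟨2 * k.1 + 1, by omega⟩

/-- The largest letter separates the letters `2 * k` and `2 * k + 1`. -/
def SplitPair {m : ℕ} (π : Equiv.Perm (Fin (2 * m + 1))) (k : Fin m) : Prop :=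
  ¬ (LeftOfMax π ⟨2 * k.1, by omega⟩ ↔ LeftOfMax π ⟨2 * k.1 + 1, by omega⟩)

open Classical in
lemma exists_splitPair {m p : ℕ} (hp : Odd p) (hpm : p < 2 * m + 1)
    (π : Equiv.Perm (Fin (2 * m + 1))) (hπ : π ⟨p, hpm⟩ = Fin.last (2 * m)) :
    ∃ k : Fin m, SplitPair π k := by
  by_contra! hall
  have hsymm : π.symm (Fin.last (2 * m)) = ⟨p, hpm⟩ := by rw [← hπ, Equiv.symm_apply_apply]
  let g : ℕ → ℕ := fun v => if h : v < 2 * m then if LeftOfMax π ⟨v, h⟩ then 1 else 0 else 0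
  have hcard : p = ∑ v ∈ Finset.range (2 * m), g v := by
    have h₁ : p = ∑ i : Fin (2 * m + 1), if i < ⟨p, hpm⟩ then 1 else 0 := by
      rw [← Finset.card_filter, Finset.filter_gt_eq_Iio, Fin.card_Iio]
    rw [← Equiv.sum_comp π.symm, Fin.sum_univ_castSucc, hsymm, if_neg (lt_irrefl _),
      add_zero] at h₁
    rw [Finset.sum_range]
    refine h₁.trans (Finset.sum_congr rfl fun j _ => ?_)
    simp only [g, LeftOfMax, hsymm, Fin.is_lt, dite_true]
  have heven : ∀ l ≤ m, Even (∑ v ∈ Finset.range (2 * l), g v) := by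
    intro l
    induction l with
    | zero => simp
    | succ l ih =>
      intro hl
      have hg : g (2 * l) = g (2 * l + 1) := by
        have := hall ⟨l, hl⟩
        simp only [SplitPair, not_not] at this
        simp only [g, dif_pos (show 2 * l < 2 * m by omega),
          dif_pos (show 2 * l + 1 < 2 * m by omega), this]
      rw [show 2 * (l + 1) = 2 * l + 1 + 1 by ring, Finset.sum_range_succ, Finset.sum_range_succ,
        hg, add_assoc]
      exact (ih (by omega)).add (Even.add_self _)
  exact (Nat.not_even_iff_odd.mpr hp) (hcard ▸ heven m le_rfl)

open Classical in
/-- The transposition of some pair of letters satisfying `P`, if there is one. -/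
noncomputable def chosenSwap {m : ℕ} (P : Fin m → Prop) : Equiv.Perm (Fin (2 * m + 1)) :=
  if h : ∃ k, P k then
    Equiv.swap ⟨2 * h.choose.1, by omega⟩ ⟨2 * h.choose.1 + 1, by omega⟩
  else 1

lemma chosenSwap_spec {m : ℕ} {P : Fin m → Prop} (h : ∃ k, P k) :
    ∃ k, P k ∧ chosenSwap P = Equiv.swap ⟨2 * k.1, by omega⟩ ⟨2 * k.1 + 1, by omega⟩ :=
  ⟨h.choose, h.choose_spec, dif_pos h⟩

lemma swap_castSucc {m : ℕ} (k : Fin m) (j : Fin (2 * m)) :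
    Equiv.swap (⟨2 * k.1, by omega⟩ : Fin (2 * m + 1)) ⟨2 * k.1 + 1, by omega⟩ j.castSucc =
      (pairSwap k j).castSucc := by
  simp only [pairSwap, Equiv.swap_apply_def, Fin.ext_iff, Fin.val_castSucc]
  split_ifs <;> rfl

lemma swap_last {m : ℕ} (k : Fin m) :
    Equiv.swap (⟨2 * k.1, by omega⟩ : Fin (2 * m + 1)) ⟨2 * k.1 + 1, by omega⟩
      (Fin.last (2 * m)) = Fin.last (2 * m) := by
  apply Equiv.swap_apply_of_ne_of_ne <;> simp only [Ne, Fin.ext_iff, Fin.val_last] <;> omega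

lemma leftOfMax_swap_mul {m : ℕ} (k : Fin m) (π : Equiv.Perm (Fin (2 * m + 1)))
    (j : Fin (2 * m)) :
    LeftOfMax (Equiv.swap ⟨2 * k.1, by omega⟩ ⟨2 * k.1 + 1, by omega⟩ * π) j ↔
      LeftOfMax π (pairSwap k j) := by
  simp only [LeftOfMax, ← Equiv.Perm.inv_def, mul_inv_rev, Equiv.swap_inv, Equiv.Perm.mul_apply,
    swap_castSucc, swap_last]

lemma splitPair_swap_mul {m : ℕ} (k l : Fin m) (π : Equiv.Perm (Fin (2 * m + 1))) :
    SplitPair (Equiv.swap ⟨2 * k.1, by omega⟩ ⟨2 * k.1 + 1, by omega⟩ * π) l ↔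
      SplitPair π l := by
  simp only [SplitPair, leftOfMax_swap_mul]
  by_cases h : l = k
  · subst h
    simp only [pairSwap, Equiv.swap_apply_left, Equiv.swap_apply_right]
    tauto
  · have h' : l.1 ≠ k.1 := fun e => h (Fin.ext e)
    rw [pairSwap, Equiv.swap_apply_of_ne_of_ne, Equiv.swap_apply_of_ne_of_ne] <;>
      simp only [Ne, Fin.ext_iff] <;> omega

/-- Exchange the letters of some pair separated by the largest letter. -/
noncomputable def swapSplitPair {m : ℕ} (π : Equiv.Perm (Fin (2 * m + 1))) :
    Equiv.Perm (Fin (2 * m + 1)) :=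
  chosenSwap (SplitPair π) * π

lemma swapSplitPair_swapSplitPair {m : ℕ} {π : Equiv.Perm (Fin (2 * m + 1))}
    (h : ∃ k, SplitPair π k) : swapSplitPair (swapSplitPair π) = π := by
  obtain ⟨k, -, hk⟩ := chosenSwap_spec h
  have hsplit : SplitPair (swapSplitPair π) = SplitPair π := by
    funext l
    rw [swapSplitPair, hk]
    exact propext (splitPair_swap_mul k l π)
  rw [swapSplitPair, hsplit, swapSplitPair, hk, Equiv.swap_mul_self_mul]

lemma swap_lt_swap_iff {m : ℕ} (k : Fin m) {x y : Fin (2 * m + 1)}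
    (h₁ : ¬ (x.1 = 2 * k.1 ∧ y.1 = 2 * k.1 + 1)) (h₂ : ¬ (y.1 = 2 * k.1 ∧ x.1 = 2 * k.1 + 1)) :
    Equiv.swap (⟨2 * k.1, by omega⟩ : Fin (2 * m + 1)) ⟨2 * k.1 + 1, by omega⟩ x <
      Equiv.swap (⟨2 * k.1, by omega⟩ : Fin (2 * m + 1)) ⟨2 * k.1 + 1, by omega⟩ y ↔ x < y := by
  simp only [Equiv.swap_apply_def, Fin.ext_iff]
  split_ifs <;> simp only [Fin.lt_def] <;> omega

/-- Letters separated by the largest letter are not adjacent. -/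
lemma leftOfMax_iff_of_adjacent {n : ℕ} (π : Equiv.Perm (Fin (n + 1))) (x y : Fin n)
    (h : (π.symm x.castSucc).1 + 1 = (π.symm y.castSucc).1) :
    LeftOfMax π x ↔ LeftOfMax π y := by
  have hne (z : Fin n) : (π.symm z.castSucc).1 ≠ (π.symm (Fin.last n)).1 := fun e =>
    (Fin.castSucc_lt_last z).ne (π.symm.injective (Fin.ext e))
  have := hne x
  have := hne y
  simp only [LeftOfMax, Fin.lt_def]
  omega

lemma desA_ascA_swapSplitPair {m : ℕ} {π : Equiv.Perm (Fin (2 * m + 1))}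
    (h : ∃ k, SplitPair π k) :
    desA (swapSplitPair π) = desA π ∧ ascA (swapSplitPair π) = ascA π := by
  obtain ⟨k, hsplit, hk⟩ := chosenSwap_spec h
  rw [swapSplitPair, hk]
  refine desA_eq_and_ascA_eq 1 fun i j hij => ?_
  obtain rfl : i = j := hij
  have symm_eq (j : Fin (2 * m + 1)) (x : Fin (2 * m)) (hx : (π j).1 = x.1) :
      π.symm x.castSucc = j := by
    rw [Equiv.symm_apply_eq]
    exact Fin.ext hx.symm
  refine swap_lt_swap_iff k (fun ⟨hx, hy⟩ => hsplit ?_) (fun ⟨hx, hy⟩ => hsplit ?_)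
  · refine (leftOfMax_iff_of_adjacent π _ _ ?_).symm
    rw [symm_eq _ ⟨2 * k.1, by omega⟩ hx, symm_eq _ ⟨2 * k.1 + 1, by omega⟩ hy]
  · refine leftOfMax_iff_of_adjacent π _ _ ?_
    rw [symm_eq _ ⟨2 * k.1, by omega⟩ hx, symm_eq _ ⟨2 * k.1 + 1, by omega⟩ hy]

lemma sign_swapSplitPair {m : ℕ} {π : Equiv.Perm (Fin (2 * m + 1))}
    (h : ∃ k, SplitPair π k) :
    Equiv.Perm.sign (swapSplitPair π) = -Equiv.Perm.sign π := by
  obtain ⟨k, -, hk⟩ := chosenSwap_spec h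
  rw [swapSplitPair, hk, map_mul, Equiv.Perm.sign_swap (by simp), neg_one_mul]

lemma sign_restrictMax_swapSplitPair {m : ℕ} {π : Equiv.Perm (Fin (2 * m + 1))}
    (h : ∃ k, SplitPair π k) :
    Equiv.Perm.sign (restrictMax (swapSplitPair π)) = -Equiv.Perm.sign (restrictMax π) := by
  obtain ⟨k, -, hk⟩ := chosenSwap_spec h
  rw [swapSplitPair, hk, restrictMax_mul _ _ (pairSwap k) (swap_last k) (swap_castSucc k),
    map_mul, pairSwap, Equiv.Perm.sign_swap (by simp), neg_one_mul]

lemma swapSplitPair_apply_eq_last {m : ℕ} {π : Equiv.Perm (Fin (2 * m + 1))}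
    (h : ∃ k, SplitPair π k) {i : Fin (2 * m + 1)} (hi : π i = Fin.last (2 * m)) :
    swapSplitPair π i = Fin.last (2 * m) := by
  obtain ⟨k, -, hk⟩ := chosenSwap_spec h
  rw [swapSplitPair, hk, Equiv.Perm.mul_apply, hi, swap_last]

theorem sum_S_eq_sum_T (m r : ℕ) (hm : 1 ≤ m) (hr : r ≤ m - 1) :
    (∑ π ∈ Finset.univ.filter (fun π : Equiv.Perm (Fin (2*m+1)) =>
        Equiv.Perm.sign π = 1 ∧ π ⟨2*r+1, by omega⟩ = Fin.last (2*m) ∧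
        Equiv.Perm.sign (restrictMax π) = -1),
      MvPolynomial.X 1 ^ desA π * MvPolynomial.X 0 ^ ascA π) =
    (∑ π ∈ Finset.univ.filter (fun π : Equiv.Perm (Fin (2*m+1)) =>
        Equiv.Perm.sign π = -1 ∧ π ⟨2*m-2*r-1, by omega⟩ = Fin.last (2*m) ∧
        Equiv.Perm.sign (restrictMax π) = 1),
      MvPolynomial.X 1 ^ desA π * MvPolynomial.X 0 ^ ascA π
      : MvPolynomial (Fin 2) ℚ) := by
  have split (π : Equiv.Perm (Fin (2 * m + 1)))
      (hπ : π ⟨2 * r + 1, by omega⟩ = Fin.last (2 * m)) : ∃ k, SplitPair π k :=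
    exists_splitPair (odd_two_mul_add_one r) _ π hπ
  trans ∑ π ∈ Finset.univ.filter (fun π : Equiv.Perm (Fin (2 * m + 1)) =>
      Equiv.Perm.sign π = -1 ∧ π ⟨2 * r + 1, by omega⟩ = Fin.last (2 * m) ∧
      Equiv.Perm.sign (restrictMax π) = 1),
    (MvPolynomial.X 1 ^ desA π * MvPolynomial.X 0 ^ ascA π : MvPolynomial (Fin 2) ℚ)
  · refine Finset.sum_nbij' swapSplitPair swapSplitPair ?_ ?_ ?_ ?_ ?_ <;> intro π hπ <;>
      simp only [Finset.mem_filter, Finset.mem_univ, true_and] at hπ ⊢ <;>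
      obtain ⟨h₁, h₂, h₃⟩ := hπ <;> have hs := split π h₂
    · rw [sign_swapSplitPair hs, sign_restrictMax_swapSplitPair hs, h₁, h₃]
      exact ⟨rfl, swapSplitPair_apply_eq_last hs h₂, neg_neg 1⟩
    · rw [sign_swapSplitPair hs, sign_restrictMax_swapSplitPair hs, h₁, h₃]
      exact ⟨neg_neg 1, swapSplitPair_apply_eq_last hs h₂, rfl⟩
    · exact swapSplitPair_swapSplitPair hs
    · exact swapSplitPair_swapSplitPair hs
    · rw [(desA_ascA_swapSplitPair hs).1, (desA_ascA_swapSplitPair hs).2]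
  · refine Finset.sum_equiv (reverseComplement (2 * m)) (fun π => ?_) (fun π hπ => ?_)
    · have hrev : Fin.rev (⟨2 * m - 2 * r - 1, by omega⟩ : Fin (2 * m + 1)) =
          ⟨2 * r + 1, by omega⟩ := by
        ext; simp only [Fin.val_rev]; omega
      simp only [Finset.mem_filter, Finset.mem_univ, true_and,
        sign_reverseComplement (even_two_mul m), sign_restrictMax_reverseComplement,
        reverseComplement_apply, complementBelowLast_eq_last_iff, hrev]
    · simp only [Finset.mem_filter, Finset.mem_univ, true_and] at hπ
      obtain ⟨hd, ha⟩ := desA_ascA_reverseComplement π (2 * r + 1) (by omega) (by omega) hπ.2.1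
      rw [hd, ha]
end

section
/- For m ≥ 1, the bivariate descent polynomial over the alternating group satisfies A_{2m+1}^+(s,t) = (s+t)·A_{2m}^+(s,t) + st·(∂/∂s + ∂/∂t) A_{2m}^+(s,t), where A_n^+(s,t) = Σ_{π ∈ A_n} t^{des(π)} s^{asc(π)}. -/
open Finset

/-- The number of cyclic descents of a permutation. -/
def cycDes {l : ℕ} (σ : Equiv.Perm (Fin (l+1))) : ℕ :=
  (Finset.univ.filter (fun i => σ (i+1) < σ i)).card

/-- The number of cyclic ascents of a permutation. -/
def cycAsc {l : ℕ} (σ : Equiv.Perm (Fin (l+1))) : ℕ :=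
  (Finset.univ.filter (fun i => σ i < σ (i+1))).card

/-- The cyclic rotation of the one-line word of `σ` starting at position `k`. -/
def rotateWord {l : ℕ} (k : Fin (l+1)) (σ : Equiv.Perm (Fin (l+1))) :
    Equiv.Perm (Fin (l+1)) :=
  (Equiv.addRight k).trans σ

/-- Prepend a new smallest letter to the one-line word of `π`. -/
def prependMin {n : ℕ} (π : Equiv.Perm (Fin n)) : Equiv.Perm (Fin (n+1)) :=
  Equiv.Perm.decomposeFin.symm (0, π)

@[simp] lemma rotateWord_apply {l : ℕ} (k : Fin (l+1)) (σ : Equiv.Perm (Fin (l+1)))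
    (i : Fin (l+1)) : rotateWord k σ i = σ (i + k) := rfl

@[simp] lemma prependMin_zero {n : ℕ} (π : Equiv.Perm (Fin n)) : prependMin π 0 = 0 := by
  simp [prependMin]

@[simp] lemma prependMin_succ {n : ℕ} (π : Equiv.Perm (Fin n)) (i : Fin n) :
    prependMin π i.succ = (π i).succ := by
  simp [prependMin]

@[simp] lemma sign_prependMin {n : ℕ} (π : Equiv.Perm (Fin n)) :
    Equiv.Perm.sign (prependMin π) = Equiv.Perm.sign π := by
  simp [prependMin]

lemma prependMin_injective {n : ℕ} :
    Function.Injective (prependMin : Equiv.Perm (Fin n) → Equiv.Perm (Fin (n+1))) := by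
  intro π π' h
  simpa [prependMin] using h

lemma desA_add_ite {l : ℕ} (σ : Equiv.Perm (Fin (l+1))) :
    desA σ + (if σ (Fin.last l + 1) < σ (Fin.last l) then 1 else 0) = cycDes σ := by
  rw [desA, cycDes, Finset.card_filter, Finset.card_filter, Fin.sum_univ_castSucc]
  simp only [Fin.coeSucc_eq_succ]
  rfl

lemma ascA_add_ite {l : ℕ} (σ : Equiv.Perm (Fin (l+1))) :
    ascA σ + (if σ (Fin.last l) < σ (Fin.last l + 1) then 1 else 0) = cycAsc σ := by
  rw [ascA, cycAsc, Finset.card_filter, Finset.card_filter, Fin.sum_univ_castSucc]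
  simp only [Fin.coeSucc_eq_succ]
  rfl

lemma cycDes_rotateWord {l : ℕ} (k : Fin (l+1)) (σ : Equiv.Perm (Fin (l+1))) :
    cycDes (rotateWord k σ) = cycDes σ := by
  rw [cycDes, cycDes, Finset.card_filter, Finset.card_filter,
    ← Equiv.sum_comp (Equiv.addRight k) fun i => if σ (i+1) < σ i then 1 else 0]
  simp only [rotateWord_apply, Equiv.coe_addRight, add_right_comm _ 1 k]
  rfl

lemma cycAsc_rotateWord {l : ℕ} (k : Fin (l+1)) (σ : Equiv.Perm (Fin (l+1))) :
    cycAsc (rotateWord k σ) = cycAsc σ := by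
  rw [cycAsc, cycAsc, Finset.card_filter, Finset.card_filter,
    ← Equiv.sum_comp (Equiv.addRight k) fun i => if σ i < σ (i+1) then 1 else 0]
  simp only [rotateWord_apply, Equiv.coe_addRight, add_right_comm _ 1 k]
  rfl

lemma cycDes_prependMin {l : ℕ} (π : Equiv.Perm (Fin (l+1))) :
    cycDes (prependMin π) = desA π + 1 := by
  rw [← desA_add_ite]
  congr 1
  · rw [desA, desA, Finset.card_filter, Finset.card_filter]
    refine (Fin.sum_univ_succ (n := l) _).trans ?_
    have h0 : ¬ prependMin π (Fin.succ 0) < prependMin π 0 := by simp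
    refine (congrArg₂ (· + ·) (if_neg h0) (Finset.sum_congr rfl fun i _ => ?_)).trans
      (zero_add _)
    have h : prependMin π i.succ.succ < prependMin π i.castSucc.succ ↔
        π i.succ < π i.castSucc := by simp
    exact if_congr h rfl rfl
  · rw [Fin.last_add_one, ← Fin.succ_last, prependMin_zero, prependMin_succ,
      if_pos (Fin.succ_pos _)]

lemma cycAsc_prependMin {l : ℕ} (π : Equiv.Perm (Fin (l+1))) :
    cycAsc (prependMin π) = ascA π + 1 := by
  rw [← ascA_add_ite]
  rw [Fin.last_add_one, ← Fin.succ_last, prependMin_zero, if_neg (Fin.not_lt_zero _), add_zero]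
  rw [ascA, ascA, Finset.card_filter, Finset.card_filter]
  refine (Fin.sum_univ_succ (n := l) _).trans ?_
  have h0 : prependMin π 0 < prependMin π (Fin.succ 0) := by
    rw [prependMin_zero, prependMin_succ]; exact Fin.succ_pos _
  refine (congrArg₂ (· + ·) (if_pos h0) (Finset.sum_congr rfl fun i _ => ?_)).trans
    (add_comm _ _)
  have h : prependMin π i.castSucc.succ < prependMin π i.succ.succ ↔
      π i.castSucc < π i.succ := by simp
  exact if_congr h rfl rfl

lemma sign_rotateWord {l : ℕ} (hl : Even l) (k : Fin (l+1)) (σ : Equiv.Perm (Fin (l+1))) :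
    Equiv.Perm.sign (rotateWord k σ) = Equiv.Perm.sign σ := by
  have h : Equiv.Perm.sign (Equiv.addRight k) = 1 := by
    have hpow : Equiv.addRight k = finRotate (l+1) ^ (k : ℕ) := by
      ext1 i
      rw [← Equiv.Perm.iterate_eq_pow, ← finCycle_eq_finRotate_iterate]
      rfl
    rw [hpow, map_pow, sign_finRotate, Nat.add_sub_cancel, hl.neg_one_pow, one_pow]
  rw [rotateWord, Equiv.Perm.sign_trans, h, mul_one]

lemma rotateWord_prependMin_bijective (n : ℕ) :
    Function.Bijective (fun p : Equiv.Perm (Fin n) × Fin (n+1) =>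
      rotateWord p.2 (prependMin p.1)) := by
  rw [Fintype.bijective_iff_injective_and_card]
  constructor
  · rintro ⟨π, k⟩ ⟨π', k'⟩ h
    have hk : k = k' := by
      have h1 := DFunLike.congr_fun h (-k)
      simp only [rotateWord_apply, neg_add_cancel, prependMin_zero] at h1
      have h2 := (prependMin π').injective ((prependMin_zero π').trans h1)
      rw [neg_add_eq_sub] at h2
      exact (sub_eq_zero.mp h2.symm).symm
    subst hk
    have hπ : prependMin π = prependMin π' := by
      ext1 i
      simpa using DFunLike.congr_fun h (i - k)
    rw [prependMin_injective hπ]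
  · simp [Fintype.card_perm, Nat.factorial_succ, mul_comm]

lemma sum_rotateWord_prependMin {l : ℕ} {R : Type*} [CommSemiring R] (s t : R)
    (π : Equiv.Perm (Fin (l+1))) :
    ∑ k, t ^ desA (rotateWord k (prependMin π)) * s ^ ascA (rotateWord k (prependMin π)) =
      (desA π + 1) * (t ^ desA π * s ^ (ascA π + 1)) +
        (ascA π + 1) * (t ^ (desA π + 1) * s ^ ascA π) := by
  set σ := prependMin π with hσ
  have hterm : ∀ k, t ^ desA (rotateWord k σ) * s ^ ascA (rotateWord k σ) =
      (if σ (Fin.last _ + k + 1) < σ (Fin.last _ + k) then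
        t ^ desA π * s ^ (ascA π + 1) else 0) +
      (if σ (Fin.last _ + k) < σ (Fin.last _ + k + 1) then
        t ^ (desA π + 1) * s ^ ascA π else 0) := by
    intro k
    have hd := desA_add_ite (rotateWord k σ)
    have ha := ascA_add_ite (rotateWord k σ)
    rw [cycDes_rotateWord, hσ, cycDes_prependMin, ← hσ] at hd
    rw [cycAsc_rotateWord, hσ, cycAsc_prependMin, ← hσ] at ha
    simp only [rotateWord_apply, add_right_comm _ 1 k] at hd ha
    have hne : σ (Fin.last _ + k) ≠ σ (Fin.last _ + k + 1) := by
      intro h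
      simpa using σ.injective h
    rcases lt_or_gt_of_ne hne with h | h
    · rw [if_neg h.not_gt, add_zero] at hd
      rw [if_pos h, add_left_inj] at ha
      rw [if_neg h.not_gt, if_pos h, hd, ha, zero_add]
    · rw [if_pos h, add_left_inj] at hd
      rw [if_neg h.not_gt, add_zero] at ha
      rw [if_neg h.not_gt, if_pos h, hd, ha, add_zero]
  have hD : ((cycDes σ : ℕ) : R) = desA π + 1 := by rw [hσ, cycDes_prependMin]; simp
  have hA : ((cycAsc σ : ℕ) : R) = ascA π + 1 := by rw [hσ, cycAsc_prependMin]; simp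
  rw [Finset.sum_congr rfl fun k _ => hterm k]
  refine (Equiv.sum_comp (Equiv.addLeft (Fin.last (l+1))) fun j =>
    (if σ (j + 1) < σ j then t ^ desA π * s ^ (ascA π + 1) else 0) +
    (if σ j < σ (j + 1) then t ^ (desA π + 1) * s ^ ascA π else 0)).trans ?_
  rw [Finset.sum_add_distrib, ← Finset.sum_filter, ← Finset.sum_filter, Finset.sum_const,
    Finset.sum_const, nsmul_eq_mul, nsmul_eq_mul, ← hD, ← hA]
  rfl

lemma Dop_sum {ι : Type*} (S : Finset ι) (f : ι → MvPolynomial (Fin 2) ℚ) :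
    Dop (∑ i ∈ S, f i) = ∑ i ∈ S, Dop (f i) := by
  simp [Dop, Finset.sum_add_distrib]

lemma add_mul_add_mul_Dop_monomial (d a : ℕ) :
    (MvPolynomial.X 0 + MvPolynomial.X 1) * (MvPolynomial.X 1 ^ d * MvPolynomial.X 0 ^ a)
      + MvPolynomial.X 0 * MvPolynomial.X 1 *
        Dop (MvPolynomial.X 1 ^ d * MvPolynomial.X 0 ^ a) =
    ((d : MvPolynomial (Fin 2) ℚ) + 1) * (MvPolynomial.X 1 ^ d * MvPolynomial.X 0 ^ (a + 1)) +
      ((a : MvPolynomial (Fin 2) ℚ) + 1) *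
        (MvPolynomial.X 1 ^ (d + 1) * MvPolynomial.X 0 ^ a) := by
  have h01 : MvPolynomial.pderiv (R := ℚ) (0 : Fin 2) (MvPolynomial.X 1) = 0 :=
    MvPolynomial.pderiv_X_of_ne (by decide)
  have h10 : MvPolynomial.pderiv (R := ℚ) (1 : Fin 2) (MvPolynomial.X 0) = 0 :=
    MvPolynomial.pderiv_X_of_ne (by decide)
  simp only [Dop, MvPolynomial.pderiv_mul, MvPolynomial.pderiv_pow, h01, h10,
    MvPolynomial.pderiv_X_self]
  cases d <;> cases a <;> simp <;> ring

theorem AbivP_succ_of_even {n : ℕ} (hn : Even n) (hpos : n ≠ 0) :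
    AbivP (n+1) = (MvPolynomial.X 0 + MvPolynomial.X 1) * AbivP n
      + MvPolynomial.X 0 * MvPolynomial.X 1 * Dop (AbivP n) := by
  obtain ⟨l, rfl⟩ := Nat.exists_eq_succ_of_ne_zero hpos
  rw [AbivP, AbivP, Dop_sum, Finset.mul_sum, Finset.mul_sum, ← Finset.sum_add_distrib,
    Finset.sum_filter, Finset.sum_filter,
    ← (rotateWord_prependMin_bijective (l+1)).sum_comp, Fintype.sum_prod_type]
  refine Finset.sum_congr rfl fun π _ => ?_
  simp only [sign_rotateWord hn, sign_prependMin]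
  split_ifs
  · rw [sum_rotateWord_prependMin, add_mul_add_mul_Dop_monomial]
  · simp

theorem AbivP_odd_recurrence (m : ℕ) (hm : 1 ≤ m) :
    AbivP (2*m+1) = (MvPolynomial.X 0 + MvPolynomial.X 1) * AbivP (2*m)
      + MvPolynomial.X 0 * MvPolynomial.X 1 * Dop (AbivP (2*m)) :=
  AbivP_succ_of_even (even_two_mul m) (by omega)
end

section
/- Let n = 2m+1 be odd and a_{n,k}^+ (resp. a_{n,k}^-) be the number of even (resp. odd) permutations of [n] with k descents. Then a_{n,k}^+ = (n-k)·a_{n-1,k-1}^+ + (k+1)·a_{n-1,k}^+ and a_{n,k}^- = (n-k)·a_{n-1,k-1}^- + (k+1)·a_{n-1,k}^-. -/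
open Finset

/-- The one-line word of a permutation, extended by zero. -/
def permWord {n : ℕ} (π : Equiv.Perm (Fin n)) (i : ℕ) : ℕ :=
  if h : i < n then (π ⟨i, h⟩ : ℕ) else 0

lemma permWord_val {n : ℕ} (π : Equiv.Perm (Fin n)) (i : Fin n) : permWord π i = π i := by
  simp [permWord]

/-- The sum of the weights `c i` over the descents `i < N` of the word `w`. -/
def descentSum (w : ℕ → ℕ) (N : ℕ) (c : ℕ → ℤ) : ℤ :=
  ∑ i ∈ range N, if w (i + 1) < w i then c i else 0

/-- The major index of a permutation of `Fin (N + 1)`. -/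
def majorIndex {N : ℕ} (π : Equiv.Perm (Fin (N + 1))) : ℤ :=
  descentSum (permWord π) N (fun i => i + 1)

lemma desA_eq_descentSum {N : ℕ} (π : Equiv.Perm (Fin (N + 1))) :
    (desA π : ℤ) = descentSum (permWord π) N (fun _ => 1) := by
  have h : descentSum (permWord π) N (fun _ => 1) =
      ∑ i : Fin N, if permWord π (i + 1) < permWord π i then (1 : ℤ) else 0 := by
    rw [descentSum, ← Fin.sum_univ_eq_sum_range
      (fun i => if permWord π (i + 1) < permWord π i then (1 : ℤ) else 0)]
  rw [h, desA, Finset.card_filter, Nat.cast_sum]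
  refine Finset.sum_congr rfl fun i _ => ?_
  have h1 := permWord_val π ⟨i.1 + 1, by have := i.2; omega⟩
  have h2 := permWord_val π ⟨i.1, by have := i.2; omega⟩
  simp only at h1 h2
  rw [h1, h2, Nat.cast_ite, Nat.cast_one, Nat.cast_zero]
  rfl

lemma descentSum_congr {w w' : ℕ → ℕ} {N : ℕ} (h : ∀ i ≤ N, w i = w' i) (c : ℕ → ℤ) :
    descentSum w N c = descentSum w' N c := by
  refine Finset.sum_congr rfl fun i hi => ?_
  have := Finset.mem_range.mp hi
  rw [h i (by omega), h (i + 1) (by omega)]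

lemma descentSum_of_interior_max {w w' : ℕ → ℕ} {N q : ℕ} (hq : q + 1 < N)
    (hmax : ∀ i ≤ N, i ≠ q + 1 → w i < w (q + 1)) (h0 : w' (q + 1) = 0)
    (hsucc : ∀ i ≤ N, i ≠ q + 1 → w' i = w i + 1) (c : ℕ → ℤ) :
    descentSum w' N c = descentSum w N c + c q - c (q + 1) := by
  have key : ∀ i ∈ range N, (if w' (i + 1) < w' i then c i else 0) =
      (if w (i + 1) < w i then c i else 0) + (if i = q then c i else 0) -
        (if i = q + 1 then c i else 0) := by
    intro i hi
    have hi := Finset.mem_range.mp hi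
    rcases eq_or_ne i q with rfl | h1
    · have := hmax i (by omega) (by omega)
      have := hsucc i (by omega) (by omega)
      rw [if_pos (by omega), if_neg (by omega)]
      simp
    · rcases eq_or_ne i (q + 1) with rfl | h2
      · have := hmax (q + 1 + 1) (by omega) (by omega)
        rw [if_neg (by omega), if_pos (by omega)]
        simp
      · have := hsucc i (by omega) h2
        have := hsucc (i + 1) (by omega) (by omega)
        have e : w' (i + 1) < w' i ↔ w (i + 1) < w i := by omega
        simp [e, h1, h2]
  rw [descentSum, Finset.sum_congr rfl key, Finset.sum_sub_distrib, Finset.sum_add_distrib]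
  simp only [Finset.sum_ite_eq', Finset.mem_range]
  rw [if_pos (by omega), if_pos hq, descentSum]

lemma descentSum_of_first_max {w : ℕ → ℕ} {M : ℕ} (h : w 1 < w 0) (c : ℕ → ℤ) :
    descentSum w (M + 1) c = c 0 + descentSum (fun i => w (i + 1)) M (fun i => c (i + 1)) := by
  simp only [descentSum, Finset.sum_range_succ', zero_add, if_pos h]
  ring

lemma descentSum_of_first_min {w : ℕ → ℕ} {M : ℕ} (h : w 0 ≤ w 1) (c : ℕ → ℤ) :
    descentSum w (M + 1) c = descentSum (fun i => w (i + 1)) M (fun i => c (i + 1)) := by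
  simp only [descentSum, Finset.sum_range_succ', zero_add, if_neg h.not_gt]
  ring

lemma descentSum_of_last_max {w : ℕ → ℕ} {M : ℕ} (h : w M ≤ w (M + 1)) (c : ℕ → ℤ) :
    descentSum w (M + 1) c = descentSum w M c := by
  simp only [descentSum, Finset.sum_range_succ, if_neg h.not_gt, add_zero]

lemma descentSum_of_last_min {w : ℕ → ℕ} {M : ℕ} (h : w (M + 1) < w M) (c : ℕ → ℤ) :
    descentSum w (M + 1) c = descentSum w M c + c M := by
  simp only [descentSum, Finset.sum_range_succ, if_pos h]

lemma descentSum_succ_word (w : ℕ → ℕ) (M : ℕ) (c : ℕ → ℤ) :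
    descentSum (fun i => w i + 1) M c = descentSum w M c := by
  simp only [descentSum, add_lt_add_iff_right]

lemma descentSum_shift_weight (w : ℕ → ℕ) (M : ℕ) :
    descentSum w M (fun i => (((i + 1 : ℕ) : ℤ) + 1)) =
      descentSum w M (fun i => (i : ℤ) + 1) + descentSum w M (fun _ => 1) := by
  simp only [descentSum, ← Finset.sum_add_distrib]
  refine Finset.sum_congr rfl fun i _ => ?_
  split_ifs <;> simp

/-- Tanimoto's operator: increase all letters by one cyclically; a largest letter standing at one
end of the word moves, as the new smallest letter, to the other end. -/
def tanimotoShift {N : ℕ} (π : Equiv.Perm (Fin (N + 1))) : Equiv.Perm (Fin (N + 1)) :=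
  if π 0 = Fin.last N then finRotate (N + 1) * π * finRotate (N + 1)
  else if π (Fin.last N) = Fin.last N then finRotate (N + 1) * π * (finRotate (N + 1))⁻¹
  else finRotate (N + 1) * π

lemma sign_finRotate_of_even {N : ℕ} (hN : Even N) :
    Equiv.Perm.sign (finRotate (N + 1)) = 1 := by
  rw [sign_finRotate, Nat.add_sub_cancel, hN.neg_one_pow]

lemma sign_tanimotoShift {N : ℕ} (hN : Even N) (π : Equiv.Perm (Fin (N + 1))) :
    Equiv.Perm.sign (tanimotoShift π) = Equiv.Perm.sign π := by
  unfold tanimotoShift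
  split_ifs <;>
    simp only [Equiv.Perm.sign_mul, Equiv.Perm.sign_inv, sign_finRotate_of_even hN, one_mul, mul_one]

lemma finRotate_inv_zero (N : ℕ) : (finRotate (N + 1))⁻¹ 0 = Fin.last N := by
  rw [Equiv.Perm.inv_eq_iff_eq, finRotate_last]

lemma finRotate_eq_zero_iff {N : ℕ} (x : Fin (N + 1)) :
    finRotate (N + 1) x = 0 ↔ x = Fin.last N := by
  rw [← finRotate_last, (finRotate (N + 1)).injective.eq_iff]

lemma val_finRotate {N : ℕ} (x : Fin (N + 1)) :
    (finRotate (N + 1) x : ℕ) = if (x : ℕ) = N then 0 else (x : ℕ) + 1 := by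
  rw [coe_finRotate]
  simp [Fin.ext_iff]

lemma last_apply_ne_last {N : ℕ} (hN : 0 < N) {π : Equiv.Perm (Fin (N + 1))}
    (h : π 0 = Fin.last N) : π (Fin.last N) ≠ Fin.last N := by
  intro h'
  have := congrArg Fin.val (π.injective (h.trans h'.symm))
  simp at this
  omega

lemma tanimotoShift_last_eq_zero_iff {N : ℕ} (π : Equiv.Perm (Fin (N + 1))) :
    tanimotoShift π (Fin.last N) = 0 ↔ π 0 = Fin.last N := by
  unfold tanimotoShift
  split_ifs with h1 h2
  · simp only [Equiv.Perm.mul_apply, finRotate_last, h1]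
  · simp only [Equiv.Perm.mul_apply, finRotate_eq_zero_iff, h1, iff_false]
    intro h
    have h3 := π.injective (h.trans h2.symm)
    rw [Equiv.Perm.inv_eq_iff_eq, finRotate_last] at h3
    exact h1 (h3 ▸ h2)
  · simp only [Equiv.Perm.mul_apply, finRotate_eq_zero_iff, h1, h2]

lemma tanimotoShift_zero_eq_zero_iff {N : ℕ} (hN : 0 < N) (π : Equiv.Perm (Fin (N + 1))) :
    tanimotoShift π 0 = 0 ↔ π (Fin.last N) = Fin.last N := by
  unfold tanimotoShift
  split_ifs with h1 h2
  · simp only [Equiv.Perm.mul_apply, finRotate_eq_zero_iff, last_apply_ne_last hN h1, iff_false]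
    intro h
    have h3 := π.injective (h.trans h1.symm)
    rw [finRotate_eq_zero_iff] at h3
    exact last_apply_ne_last hN h1 (h3 ▸ h1)
  · simp only [Equiv.Perm.mul_apply, finRotate_eq_zero_iff, finRotate_inv_zero, h2]
  · simp only [Equiv.Perm.mul_apply, finRotate_eq_zero_iff, h1, h2]

lemma tanimotoShift_injective {N : ℕ} (hN : 0 < N) :
    Function.Injective (tanimotoShift (N := N)) := by
  intro π ρ h
  have h1 : π 0 = Fin.last N ↔ ρ 0 = Fin.last N := by
    rw [← tanimotoShift_last_eq_zero_iff, h, tanimotoShift_last_eq_zero_iff]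
  have h2 : π (Fin.last N) = Fin.last N ↔ ρ (Fin.last N) = Fin.last N := by
    rw [← tanimotoShift_zero_eq_zero_iff hN, h, tanimotoShift_zero_eq_zero_iff hN]
  unfold tanimotoShift at h
  simp only [h1, h2] at h
  split_ifs at h <;> simpa only [mul_left_inj, mul_right_inj] using h

lemma permWord_zero {N : ℕ} (π : Equiv.Perm (Fin (N + 1))) : permWord π 0 = π 0 :=
  permWord_val π 0

lemma permWord_last {N : ℕ} (π : Equiv.Perm (Fin (N + 1))) :
    permWord π N = π (Fin.last N) :=
  permWord_val π (Fin.last N)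

lemma permWord_le {N : ℕ} (π : Equiv.Perm (Fin (N + 1))) (i : ℕ) : permWord π i ≤ N := by
  unfold permWord
  split_ifs <;> omega

lemma permWord_inj {N : ℕ} (π : Equiv.Perm (Fin (N + 1))) {i j : ℕ} (hi : i ≤ N) (hj : j ≤ N)
    (h : permWord π i = permWord π j) : i = j := by
  have h1 := permWord_val π ⟨i, by omega⟩
  have h2 := permWord_val π ⟨j, by omega⟩
  simp only at h1 h2
  rw [h1, h2] at h
  simpa using π.injective (Fin.ext h)

lemma permWord_lt {N : ℕ} (π : Equiv.Perm (Fin (N + 1))) {i j : ℕ} (hi : i ≤ N) (hj : j ≤ N)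
    (h : permWord π i = N) (hij : j ≠ i) : permWord π j < N :=
  lt_of_le_of_ne (permWord_le π j) fun h' => hij (permWord_inj π hj hi (h'.trans h.symm))

lemma permWord_finRotate_mul {N : ℕ} (π : Equiv.Perm (Fin (N + 1))) {i : ℕ} (hi : i ≤ N) :
    permWord (finRotate (N + 1) * π) i = if permWord π i = N then 0 else permWord π i + 1 := by
  have h1 := permWord_val π ⟨i, by omega⟩
  have h2 := permWord_val (finRotate (N + 1) * π) ⟨i, by omega⟩
  simp only at h1 h2
  rw [h1, h2, Equiv.Perm.mul_apply, val_finRotate]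

lemma permWord_mul_finRotate {N : ℕ} (π : Equiv.Perm (Fin (N + 1))) {i : ℕ} (hi : i ≤ N) :
    permWord (π * finRotate (N + 1)) i = if i = N then permWord π 0 else permWord π (i + 1) := by
  have h2 := permWord_val (π * finRotate (N + 1)) ⟨i, by omega⟩
  have h3 := val_finRotate (⟨i, by omega⟩ : Fin (N + 1))
  simp only at h2 h3
  rw [h2, Equiv.Perm.mul_apply, ← permWord_val, h3]
  split_ifs <;> rfl

lemma permWord_mul_finRotate_inv {N : ℕ} (π : Equiv.Perm (Fin (N + 1))) {i : ℕ} (hi : i < N) :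
    permWord (π * (finRotate (N + 1))⁻¹) (i + 1) = permWord π i := by
  have h := permWord_mul_finRotate (π * (finRotate (N + 1))⁻¹) hi.le
  rw [inv_mul_cancel_right, if_neg hi.ne] at h
  exact h.symm

lemma permWord_mul_finRotate_inv_zero {N : ℕ} (π : Equiv.Perm (Fin (N + 1))) :
    permWord (π * (finRotate (N + 1))⁻¹) 0 = permWord π N := by
  have h := permWord_mul_finRotate (π * (finRotate (N + 1))⁻¹) le_rfl
  rw [inv_mul_cancel_right, if_pos rfl] at h
  exact h.symm

lemma descentSum_tanimotoShift_of_first {M : ℕ} {π : Equiv.Perm (Fin (M + 2))}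
    (h : π 0 = Fin.last (M + 1)) (c : ℕ → ℤ) :
    descentSum (permWord (tanimotoShift π)) (M + 1) c =
      descentSum (fun i => permWord π (i + 1)) M c + c M := by
  have h0 : permWord π 0 = M + 1 := by rw [permWord_zero, h, Fin.val_last]
  have hlt : ∀ i ≤ M, permWord π (i + 1) < M + 1 := fun i hi =>
    permWord_lt π (Nat.zero_le _) (by omega) h0 (by omega)
  have hw : ∀ i ≤ M, permWord (tanimotoShift π) i = permWord π (i + 1) + 1 := by
    intro i hi
    rw [tanimotoShift, if_pos h, mul_assoc, permWord_finRotate_mul _ (by omega),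
      permWord_mul_finRotate _ (by omega), if_neg (show i ≠ M + 1 by omega),
      if_neg (hlt i hi).ne]
  have hl : permWord (tanimotoShift π) (M + 1) = 0 := by
    rw [tanimotoShift, if_pos h, mul_assoc, permWord_finRotate_mul _ (by omega),
      permWord_mul_finRotate _ (by omega), if_pos rfl, if_pos h0]
  rw [descentSum_of_last_min (by rw [hl, hw M le_rfl]; omega), descentSum_congr hw,
    descentSum_succ_word]

lemma descentSum_tanimotoShift_of_last {M : ℕ} {π : Equiv.Perm (Fin (M + 2))}
    (h : π (Fin.last (M + 1)) = Fin.last (M + 1)) (c : ℕ → ℤ) :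
    descentSum (permWord (tanimotoShift π)) (M + 1) c =
      descentSum (permWord π) M (fun i => c (i + 1)) := by
  have h' : π 0 ≠ Fin.last (M + 1) := fun h0 => last_apply_ne_last (Nat.succ_pos M) h0 h
  have h0 : permWord π (M + 1) = M + 1 := by rw [permWord_last, h, Fin.val_last]
  have hlt : ∀ i ≤ M, permWord π i < M + 1 := fun i hi =>
    permWord_lt π le_rfl (by omega) h0 (by omega)
  have hw : ∀ i ≤ M, permWord (tanimotoShift π) (i + 1) = permWord π i + 1 := by
    intro i hi
    rw [tanimotoShift, if_neg h', if_pos h, mul_assoc, permWord_finRotate_mul _ (by omega),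
      permWord_mul_finRotate_inv _ (by omega), if_neg (hlt i hi).ne]
  have hl : permWord (tanimotoShift π) 0 = 0 := by
    rw [tanimotoShift, if_neg h', if_pos h, mul_assoc, permWord_finRotate_mul _ (by omega),
      permWord_mul_finRotate_inv_zero, if_pos h0]
  rw [descentSum_of_first_min (by rw [hl]; omega), descentSum_congr hw, descentSum_succ_word]

lemma descentSum_tanimotoShift_of_interior {N : ℕ} {π : Equiv.Perm (Fin (N + 1))}
    (h0 : π 0 ≠ Fin.last N) (hN : π (Fin.last N) ≠ Fin.last N) :
    ∃ q, ∀ c : ℕ → ℤ, descentSum (permWord (tanimotoShift π)) N c =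
      descentSum (permWord π) N c + c q - c (q + 1) := by
  obtain ⟨p, hp⟩ := π.surjective (Fin.last N)
  have hp0 : (p : ℕ) ≠ 0 := fun h => h0 (by rwa [show (0 : Fin (N + 1)) = p from Fin.ext h.symm])
  have hpN : (p : ℕ) ≠ N := fun h => hN (by rwa [show Fin.last N = p from Fin.ext h.symm] at hp ⊢)
  obtain ⟨q, hq⟩ := Nat.exists_eq_succ_of_ne_zero hp0
  have hpw : permWord π (q + 1) = N := by
    have h := permWord_val π p
    rwa [hq, hp, Fin.val_last] at h
  have hqN : q + 1 < N := by omega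
  have hlt : ∀ i ≤ N, i ≠ q + 1 → permWord π i < N := fun i hi hne =>
    permWord_lt π hqN.le hi hpw hne
  refine ⟨q, descentSum_of_interior_max hqN (by rwa [hpw]) ?_ fun i hi hne => ?_⟩
  · rw [tanimotoShift, if_neg h0, if_neg hN, permWord_finRotate_mul _ hqN.le, if_pos hpw]
  · rw [tanimotoShift, if_neg h0, if_neg hN, permWord_finRotate_mul _ hi,
      if_neg (hlt i hi hne).ne]

lemma descentSum_permWord_of_first {M : ℕ} {π : Equiv.Perm (Fin (M + 2))}
    (h : π 0 = Fin.last (M + 1)) (c : ℕ → ℤ) : descentSum (permWord π) (M + 1) c =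
      c 0 + descentSum (fun i => permWord π (i + 1)) M (fun i => c (i + 1)) := by
  have h0 : permWord π 0 = M + 1 := by rw [permWord_zero, h, Fin.val_last]
  refine descentSum_of_first_max ?_ c
  rw [h0]
  exact permWord_lt π (Nat.zero_le _) (by omega) h0 (by omega)

lemma descentSum_permWord_of_last {M : ℕ} {π : Equiv.Perm (Fin (M + 2))}
    (h : π (Fin.last (M + 1)) = Fin.last (M + 1)) (c : ℕ → ℤ) :
    descentSum (permWord π) (M + 1) c = descentSum (permWord π) M c := by
  refine descentSum_of_last_max ?_ c
  rw [permWord_last, h, Fin.val_last]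
  exact permWord_le π M

lemma desA_tanimotoShift {M : ℕ} (π : Equiv.Perm (Fin (M + 2))) :
    desA (tanimotoShift π) = desA π := by
  zify
  rw [desA_eq_descentSum, desA_eq_descentSum]
  by_cases h0 : π 0 = Fin.last (M + 1)
  · rw [descentSum_tanimotoShift_of_first h0, descentSum_permWord_of_first h0, add_comm]
  · by_cases hN : π (Fin.last (M + 1)) = Fin.last (M + 1)
    · rw [descentSum_tanimotoShift_of_last hN, descentSum_permWord_of_last hN]
    · obtain ⟨q, hq⟩ := descentSum_tanimotoShift_of_interior h0 hN
      rw [hq, add_sub_cancel_right]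

lemma majorIndex_tanimotoShift {M : ℕ} (π : Equiv.Perm (Fin (M + 2))) :
    majorIndex (tanimotoShift π) = majorIndex π - 1 +
      (if π (Fin.last (M + 1)) = Fin.last (M + 1) then (desA π : ℤ) + 1 else 0) +
      (if π 0 = Fin.last (M + 1) then (M : ℤ) + 2 - desA π else 0) := by
  rw [desA_eq_descentSum, majorIndex, majorIndex]
  by_cases h0 : π 0 = Fin.last (M + 1)
  · rw [descentSum_tanimotoShift_of_first h0, descentSum_permWord_of_first h0,
      descentSum_permWord_of_first h0, descentSum_shift_weight, if_neg (last_apply_ne_last (Nat.succ_pos M) h0), if_pos h0]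
    push_cast
    ring
  · by_cases hN : π (Fin.last (M + 1)) = Fin.last (M + 1)
    · rw [descentSum_tanimotoShift_of_last hN, descentSum_permWord_of_last hN,
        descentSum_permWord_of_last hN, descentSum_shift_weight, if_pos hN, if_neg h0]
      ring
    · obtain ⟨q, hq⟩ := descentSum_tanimotoShift_of_interior h0 hN
      rw [hq, if_neg h0, if_neg hN]
      push_cast
      ring

/-- The permutations of `Fin n` with sign `ε` and `k` descents. -/
def signedDescentClass (n : ℕ) (ε : ℤˣ) (k : ℤ) : Finset (Equiv.Perm (Fin n)) :=
  Finset.univ.filter (fun π => Equiv.Perm.sign π = ε ∧ (desA π : ℤ) = k)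

lemma sum_tanimotoShift_signedDescentClass {M : ℕ} (hM : Even (M + 1)) (ε : ℤˣ) (k : ℤ)
    (f : Equiv.Perm (Fin (M + 2)) → ℤ) :
    ∑ π ∈ signedDescentClass (M + 2) ε k, f (tanimotoShift π) =
      ∑ π ∈ signedDescentClass (M + 2) ε k, f π := by
  have hbij := Finite.injective_iff_bijective.mp (tanimotoShift_injective (Nat.succ_pos M))
  refine Finset.sum_bijective tanimotoShift hbij (fun π => ?_) fun _ _ => rfl
  simp only [signedDescentClass, Finset.mem_filter, Finset.mem_univ, true_and,
    sign_tanimotoShift hM, desA_tanimotoShift]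

lemma card_signedDescentClass_eq {M : ℕ} (hM : Even (M + 1)) (ε : ℤˣ) (k : ℤ) :
    ((signedDescentClass (M + 2) ε k).card : ℤ) =
      (M + 2 - k) * ((signedDescentClass (M + 2) ε k).filter
        (fun π => π 0 = Fin.last (M + 1))).card +
      (k + 1) * ((signedDescentClass (M + 2) ε k).filter
        (fun π => π (Fin.last (M + 1)) = Fin.last (M + 1))).card := by
  have h := sum_tanimotoShift_signedDescentClass hM ε k majorIndex
  have h' : ∑ π ∈ signedDescentClass (M + 2) ε k, majorIndex (tanimotoShift π) =
      ∑ π ∈ signedDescentClass (M + 2) ε k, (majorIndex π - 1 +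
        (if π (Fin.last (M + 1)) = Fin.last (M + 1) then k + 1 else 0) +
        (if π 0 = Fin.last (M + 1) then (M : ℤ) + 2 - k else 0)) := by
    refine Finset.sum_congr rfl fun π hπ => ?_
    rw [majorIndex_tanimotoShift, (Finset.mem_filter.mp hπ).2.2]
  rw [h', Finset.sum_add_distrib, Finset.sum_add_distrib, Finset.sum_sub_distrib,
    ← Finset.sum_filter, ← Finset.sum_filter] at h
  simp only [Finset.sum_const, nsmul_eq_mul, mul_one] at h
  linarith

/-- Append the largest letter to the word of a permutation. -/
def appendMax {N : ℕ} (τ : Equiv.Perm (Fin N)) : Equiv.Perm (Fin (N + 1)) :=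
  finSuccEquivLast.symm.permCongr (Equiv.optionCongr τ)

lemma appendMax_last {N : ℕ} (τ : Equiv.Perm (Fin N)) :
    appendMax τ (Fin.last N) = Fin.last N := by
  simp [appendMax]

lemma appendMax_castSucc {N : ℕ} (τ : Equiv.Perm (Fin N)) (i : Fin N) :
    appendMax τ i.castSucc = (τ i).castSucc := by
  simp [appendMax]

lemma sign_appendMax {N : ℕ} (τ : Equiv.Perm (Fin N)) :
    Equiv.Perm.sign (appendMax τ) = Equiv.Perm.sign τ := by
  rw [appendMax, Equiv.Perm.sign_permCongr, Equiv.optionCongr_sign]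

lemma appendMax_injective (N : ℕ) : Function.Injective (appendMax (N := N)) := by
  intro τ τ' h
  ext i
  have := congrArg (fun σ => (σ i.castSucc : Fin (N + 1)).val) h
  simpa [appendMax_castSucc] using this

lemma exists_appendMax_eq {N : ℕ} {π : Equiv.Perm (Fin (N + 1))}
    (h : π (Fin.last N) = Fin.last N) : ∃ τ, appendMax τ = π := by
  have hnone : finSuccEquivLast.permCongr π none = none := by
    simp [Equiv.permCongr_apply, h]
  refine ⟨Equiv.removeNone (finSuccEquivLast.permCongr π), ?_⟩
  rw [appendMax, map_equiv_removeNone, hnone, Equiv.swap_self]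
  ext i
  simp [Equiv.permCongr_apply, ← Equiv.Perm.one_def]

lemma permWord_appendMax {N : ℕ} (τ : Equiv.Perm (Fin N)) {i : ℕ} (hi : i < N) :
    permWord (appendMax τ) i = permWord τ i := by
  have h1 := permWord_val τ ⟨i, hi⟩
  have h2 := permWord_val (appendMax τ) (Fin.castSucc ⟨i, hi⟩)
  rw [appendMax_castSucc] at h2
  simp only [Fin.val_castSucc] at h1 h2
  rw [h1, h2]

lemma desA_appendMax {M : ℕ} (τ : Equiv.Perm (Fin (M + 1))) :
    desA (appendMax τ) = desA τ := by
  zify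
  rw [desA_eq_descentSum, desA_eq_descentSum, descentSum_permWord_of_last (appendMax_last τ)]
  exact descentSum_congr (fun i hi => permWord_appendMax τ (by omega)) _

lemma desA_appendMax_mul_finRotate_inv {M : ℕ} (τ : Equiv.Perm (Fin (M + 1))) :
    (desA (appendMax τ * (finRotate (M + 2))⁻¹) : ℤ) = desA τ + 1 := by
  have h0 : (appendMax τ * (finRotate (M + 2))⁻¹) 0 = Fin.last (M + 1) := by
    rw [Equiv.Perm.mul_apply, finRotate_inv_zero, appendMax_last]
  rw [desA_eq_descentSum, desA_eq_descentSum, descentSum_permWord_of_first h0, add_comm]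
  congr 1
  refine descentSum_congr (fun i hi => ?_) _
  rw [permWord_mul_finRotate_inv _ (by omega), permWord_appendMax τ (by omega)]

lemma card_filter_last_signedDescentClass (M : ℕ) (ε : ℤˣ) (k : ℤ) :
    ((signedDescentClass (M + 2) ε k).filter
      (fun π => π (Fin.last (M + 1)) = Fin.last (M + 1))).card =
      (signedDescentClass (M + 1) ε k).card := by
  symm
  refine Finset.card_bij (fun τ _ => appendMax τ) (fun τ hτ => ?_)
    (fun τ _ τ' _ h => appendMax_injective _ h) fun π hπ => ?_
  · simpa [signedDescentClass, appendMax_last, sign_appendMax, desA_appendMax] using hτ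
  · obtain ⟨hπ, hl⟩ := Finset.mem_filter.mp hπ
    obtain ⟨τ, rfl⟩ := exists_appendMax_eq hl
    refine ⟨τ, ?_, rfl⟩
    simpa [signedDescentClass, sign_appendMax, desA_appendMax] using hπ

lemma card_filter_zero_signedDescentClass {M : ℕ} (hM : Even (M + 1)) (ε : ℤˣ) (k : ℤ) :
    ((signedDescentClass (M + 2) ε k).filter (fun π => π 0 = Fin.last (M + 1))).card =
      (signedDescentClass (M + 1) ε (k - 1)).card := by
  have key : ∀ τ : Equiv.Perm (Fin (M + 1)),
      appendMax τ * (finRotate (M + 2))⁻¹ ∈ signedDescentClass (M + 2) ε k ↔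
        τ ∈ signedDescentClass (M + 1) ε (k - 1) := by
    intro τ
    simp only [signedDescentClass, Finset.mem_filter, Finset.mem_univ, true_and,
      Equiv.Perm.sign_mul, Equiv.Perm.sign_inv, sign_finRotate_of_even hM, mul_one,
      sign_appendMax, desA_appendMax_mul_finRotate_inv, eq_sub_iff_add_eq]
  symm
  refine Finset.card_bij (fun τ _ => appendMax τ * (finRotate (M + 2))⁻¹) (fun τ hτ => ?_)
    (fun τ _ τ' _ h => appendMax_injective _ (mul_right_cancel h)) fun π hπ => ?_
  · refine Finset.mem_filter.mpr ⟨(key τ).mpr hτ, ?_⟩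
    rw [Equiv.Perm.mul_apply, finRotate_inv_zero, appendMax_last]
  · obtain ⟨hπ, h0⟩ := Finset.mem_filter.mp hπ
    obtain ⟨τ, hτ⟩ := exists_appendMax_eq (π := π * finRotate (M + 2))
      (by rw [Equiv.Perm.mul_apply, finRotate_last, h0])
    have hπτ : appendMax τ * (finRotate (M + 2))⁻¹ = π := by rw [hτ, mul_inv_cancel_right]
    exact ⟨τ, (key τ).mp (hπτ ▸ hπ), hπτ⟩

lemma card_signedDescentClass_recurrence {N : ℕ} (hN : Even N) (hpos : 0 < N) (ε : ℤˣ) (k : ℤ) :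
    ((signedDescentClass (N + 1) ε k).card : ℤ) =
      (N + 1 - k) * (signedDescentClass N ε (k - 1)).card +
      (k + 1) * (signedDescentClass N ε k).card := by
  obtain ⟨M, rfl⟩ := Nat.exists_eq_succ_of_ne_zero hpos.ne'
  have h := card_signedDescentClass_eq hN ε k
  rw [card_filter_zero_signedDescentClass hN, card_filter_last_signedDescentClass] at h
  rw [h]
  push_cast
  ring

theorem tanimoto_recurrence_odd (m : ℕ) (hm : 1 ≤ m) (k : ℤ) :
    (aP (2*m+1) k : ℤ) = ((2*m+1 : ℤ) - k) * aP (2*m) (k-1) + (k+1) * aP (2*m) k ∧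
    (aM (2*m+1) k : ℤ) = ((2*m+1 : ℤ) - k) * aM (2*m) (k-1) + (k+1) * aM (2*m) k := by
  have h := card_signedDescentClass_recurrence (even_two_mul m) (by omega)
  push_cast at h
  exact ⟨h 1 k, h (-1) k⟩
end

section
/- For n ≡ 0 or 1 (mod 4) with n ≥ 4, both A_n^+(s,t) = Σ_{π ∈ A_n} t^{des(π)} s^{asc(π)} and A_n^-(s,t) = Σ_{π ∈ S_n \ A_n} t^{des(π)} s^{asc(π)} are gamma positive: each can be written as Σ_{i} γ_i (st)^i (s+t)^{n-1-2i} with nonnegative integers γ_i (indices starting at the least power of st appearing). -/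
open Finset

section Sorting

/-- The number of ascents of `π` among the positions strictly before `i`. -/
def ascBefore {m : ℕ} (π : Equiv.Perm (Fin (m + 1))) (i : ℕ) : ℕ :=
  (univ.filter (fun j : Fin m => j.1 < i ∧ π j.castSucc < π j.succ)).card

lemma ascBefore_zero {m : ℕ} (π : Equiv.Perm (Fin (m + 1))) : ascBefore π 0 = 0 := by
  simp [ascBefore]

lemma ascBefore_last {m : ℕ} (π : Equiv.Perm (Fin (m + 1))) : ascBefore π m = ascA π := by
  unfold ascBefore ascA
  congr 1
  ext j
  have := j.2
  simp [Fin.castSucc, Fin.succ, Fin.castAdd, Fin.castLE]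

lemma ascBefore_succ {m : ℕ} (π : Equiv.Perm (Fin (m + 1))) (i : Fin m) :
    ascBefore π (i.1 + 1) = ascBefore π i.1 + if π i.castSucc < π i.succ then 1 else 0 := by
  unfold ascBefore
  split_ifs with h
  · rw [← card_insert_of_notMem (a := i) (by simp)]
    congr 1
    ext j
    simp only [mem_filter, mem_univ, true_and, mem_insert, Fin.ext_iff, Order.lt_add_one_iff]
    constructor
    · rintro ⟨h1, h2⟩
      rcases h1.lt_or_eq with h3 | h3
      · exact Or.inr ⟨h3, h2⟩
      · exact Or.inl h3
    · rintro (h1 | ⟨h1, h2⟩)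
      · obtain rfl : j = i := Fin.ext h1
        exact ⟨le_rfl, h⟩
      · exact ⟨h1.le, h2⟩
  · rw [add_zero]
    congr 1
    ext j
    simp only [mem_filter, mem_univ, true_and, Order.lt_add_one_iff, and_congr_left_iff]
    intro h2
    refine ⟨fun h1 => lt_of_le_of_ne h1 fun h3 => h ?_, le_of_lt⟩
    obtain rfl : j = i := Fin.ext h3
    exact h2

lemma sort_eq_iff_succ {m k : ℕ} (f : Fin (m + 1) → Fin k) (π : Equiv.Perm (Fin (m + 1))) :
    Tuple.sort f = π ↔ ∀ i : Fin m,
      (f (π i.castSucc)).1 + (if π i.castSucc < π i.succ then 0 else 1) ≤ (f (π i.succ)).1 := by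
  rw [eq_comm, Tuple.eq_sort_iff', Fin.strictMono_iff_lt_succ]
  refine forall_congr' fun i => ?_
  change toLex (f (π i.castSucc), π i.castSucc) < toLex (f (π i.succ), π i.succ) ↔ _
  rw [Prod.Lex.toLex_lt_toLex]
  simp only [Fin.lt_def, Fin.ext_iff]
  split_ifs <;> omega

lemma card_sort_fiber {m k : ℕ} (π : Equiv.Perm (Fin (m + 1))) :
    (univ.filter (fun f : Fin (m + 1) → Fin k => Tuple.sort f = π)).card
      = (k + ascA π).choose (m + 1) := by
  have hcard : Fintype.card (Fin (m + 1) ↪o Fin (k + ascA π)) = (k + ascA π).choose (m + 1) := by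
    rw [← Nat.card_eq_fintype_card, Nat.card_congr Set.powersetCard.ofFinEmbEquiv,
      Set.powersetCard.card, Nat.card_fin]
  rw [← hcard, ← Finset.card_univ]
  have hmono : Monotone (ascBefore π) := fun a b hab =>
    card_le_card fun j hj => by
      simp only [mem_filter, mem_univ, true_and] at hj ⊢
      exact ⟨hj.1.trans_le hab, hj.2⟩
  have hle (i : Fin (m + 1)) : ascBefore π i ≤ ascA π := by
    rw [← ascBefore_last]
    exact hmono (Nat.lt_succ_iff.1 i.2)
  have hlow (h : Fin (m + 1) ↪o Fin (k + ascA π)) (i : Fin (m + 1)) :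
      ascBefore π i ≤ (h i).1 := by
    induction i using Fin.induction with
    | zero => simp [ascBefore_zero]
    | succ i ih =>
      have h1 := ascBefore_succ π i
      have h2 : (h i.castSucc).1 < (h i.succ).1 := h.strictMono (Fin.castSucc_lt_succ)
      simp only [Fin.val_castSucc, Fin.val_succ] at ih ⊢
      split_ifs at h1 <;> omega
  have hstep (h : Fin (m + 1) ↪o Fin (k + ascA π)) (i : Fin m) :
      (h i.castSucc).1 - ascBefore π i.castSucc + (if π i.castSucc < π i.succ then 0 else 1)
        ≤ (h i.succ).1 - ascBefore π i.succ := by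
    have h0 := hlow h i.castSucc
    have h1 := ascBefore_succ π i
    have h2 : (h i.castSucc).1 < (h i.succ).1 := h.strictMono (Fin.castSucc_lt_succ)
    simp only [Fin.val_castSucc, Fin.val_succ] at h0 ⊢
    split_ifs at h1 ⊢ <;> omega
  have hup (h : Fin (m + 1) ↪o Fin (k + ascA π)) (i : Fin (m + 1)) :
      (h i).1 - ascBefore π i < k := by
    have hm : Monotone (fun i : Fin (m + 1) => (h i).1 - ascBefore π i) :=
      Fin.monotone_iff_le_succ.2 fun i => (Nat.le_add_right _ _).trans (hstep h i)
    refine (hm (Fin.le_last i)).trans_lt ?_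
    have h1 := hlow h (Fin.last m)
    have h2 := (h (Fin.last m)).2
    have h3 := ascBefore_last π
    simp only [Fin.val_last] at h1 ⊢
    omega
  refine card_bij'
    (fun f hf => OrderEmbedding.ofStrictMono
      (fun i => (⟨(f (π i)).1 + ascBefore π i, by
        have := (f (π i)).2
        have := hle i
        omega⟩ : Fin (k + ascA π)))
      (Fin.strictMono_iff_lt_succ.2 fun i => by
        have h1 := (sort_eq_iff_succ f π).1 (mem_filter.1 hf).2 i
        have h2 := ascBefore_succ π i
        simp only [Fin.lt_def, Fin.val_castSucc, Fin.val_succ] at h1 h2 ⊢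
        split_ifs at h1 h2 <;> omega))
    (fun h _ x => ⟨(h (π.symm x)).1 - ascBefore π (π.symm x), hup h _⟩)
    (fun _ _ => mem_univ _) ?_ ?_ ?_
  · intro h _
    simp only [mem_filter, mem_univ, true_and]
    rw [sort_eq_iff_succ]
    intro i
    simpa using hstep h i
  · intro f _
    ext x
    simp
  · intro h _
    ext i
    simp [hlow h i]

lemma sum_mul_choose_eq_sum_sort {m k : ℕ} (w : Equiv.Perm (Fin (m + 1)) → ℚ) :
    ∑ π, w π * ((k + ascA π).choose (m + 1) : ℚ)
      = ∑ f : Fin (m + 1) → Fin k, w (Tuple.sort f) := by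
  rw [← sum_fiberwise univ (fun f : Fin (m + 1) → Fin k => Tuple.sort f)]
  refine sum_congr rfl fun π _ => ?_
  rw [← card_sort_fiber, sum_congr rfl fun f hf => by rw [(mem_filter.1 hf).2], sum_const,
    nsmul_eq_mul, mul_comm]

/-- The sign `(-1) ^ inv f` of a word `f`. -/
def wordSign {n k : ℕ} (f : Fin n → Fin k) : ℚ :=
  ∏ i, ∏ j ∈ Ioi i, if f i ≤ f j then 1 else -1

lemma sign_sort {n k : ℕ} (f : Fin n → Fin k) :
    (((Equiv.Perm.sign (Tuple.sort f) : ℤˣ) : ℤ) : ℚ) = wordSign f := by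
  rw [← Equiv.Perm.sign_inv, Equiv.Perm.sign_eq_prod_prod_Ioi, wordSign]
  push_cast
  refine prod_congr rfl fun i _ => prod_congr rfl fun j hj => ?_
  rw [mem_Ioi] at hj
  have key : ∀ a b, (Tuple.sort f)⁻¹ a < (Tuple.sort f)⁻¹ b ↔
      toLex (f a, a) < toLex (f b, b) := fun a b => by
    have := ((Tuple.eq_sort_iff' (f := f)).1 rfl).lt_iff_lt
      (a := (Tuple.sort f)⁻¹ a) (b := (Tuple.sort f)⁻¹ b)
    rw [← this]
    change toLex (f (Tuple.sort f ((Tuple.sort f)⁻¹ a)), Tuple.sort f ((Tuple.sort f)⁻¹ a)) <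
      toLex (f (Tuple.sort f ((Tuple.sort f)⁻¹ b)), Tuple.sort f ((Tuple.sort f)⁻¹ b)) ↔ _
    simp
  have h2 : (Tuple.sort f)⁻¹ i < (Tuple.sort f)⁻¹ j ↔ f i ≤ f j := by
    rw [key, Prod.Lex.toLex_lt_toLex]
    simp only [hj, and_true]
    exact le_iff_lt_or_eq.symm
  simp only [h2]
  split_ifs <;> simp

lemma wordSign_cons {n k : ℕ} (a : Fin k) (f : Fin n → Fin k) :
    wordSign (Fin.cons a f : Fin (n + 1) → Fin k)
      = (∏ j, if a ≤ f j then 1 else -1) * wordSign f := by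
  simp [wordSign, Fin.prod_univ_succ, Fin.prod_Ioi_succ]

lemma sum_wordSign_add_two (n k : ℕ) :
    ∑ f : Fin (n + 2) → Fin k, wordSign f = k * ∑ f : Fin n → Fin k, wordSign f := by
  rw [← (Fin.consEquiv fun _ => Fin k).sum_comp, Fintype.sum_prod_type]
  have h1 : ∀ a : Fin k, ∑ f : Fin (n + 1) → Fin k,
      wordSign (Fin.consEquiv (fun _ => Fin k) (a, f)) = ∑ b : Fin k, ∑ f : Fin n → Fin k,
        (if a ≤ b then 1 else -1) * (∏ j, if a ≤ f j then 1 else -1) *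
          ((∏ j, if b ≤ f j then 1 else -1) * wordSign f) := by
    intro a
    rw [← (Fin.consEquiv fun _ => Fin k).sum_comp, Fintype.sum_prod_type]
    refine sum_congr rfl fun b _ => sum_congr rfl fun f _ => ?_
    change wordSign (Fin.cons a (Fin.cons b f)) = _
    rw [wordSign_cons, wordSign_cons, Fin.prod_univ_succ]
    simp
  rw [sum_congr rfl fun a _ => h1 a, sum_congr rfl fun a _ => sum_comm, sum_comm, mul_sum]
  refine sum_congr rfl fun f _ => ?_
  set G : Fin k → ℚ := fun a => ∏ j, if a ≤ f j then 1 else -1 with hG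
  have hG2 : ∀ a, G a * G a = 1 := fun a => by
    simp only [hG, ← prod_mul_distrib]
    refine prod_eq_one fun j _ => ?_
    split_ifs <;> norm_num
  set F : Fin k → Fin k → ℚ := fun a b => (if a ≤ b then 1 else -1) * G a * (G b * wordSign f)
  have hF : ∀ a b, F a b + F b a = if a = b then 2 * wordSign f else 0 := by
    intro a b
    rcases lt_trichotomy a b with h | h | h
    · simp only [F, h.le, h.ne, h.not_ge, if_true, if_false]; ring
    · subst h
      simp only [F, le_refl, if_true]
      linear_combination 2 * wordSign f * hG2 a
    · simp only [F, h.le, h.ne', h.not_ge, if_true, if_false]; ring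
  have h2 : ∑ a, ∑ b, F a b + ∑ a, ∑ b, F a b = 2 * (k * wordSign f) := by
    nth_rewrite 2 [sum_comm]
    simp only [← sum_add_distrib, hF]
    simp
    ring
  change ∑ a, ∑ b, F a b = _
  linarith

lemma sum_wordSign (n k : ℕ) :
    ∑ f : Fin n → Fin k, wordSign f = (k : ℚ) ^ ((n + 1) / 2) := by
  induction n using Nat.twoStepInduction with
  | zero => simp [wordSign]
  | one => simp [wordSign]
  | more n ih _ =>
    rw [sum_wordSign_add_two, ih, show (n + 2 + 1) / 2 = (n + 1) / 2 + 1 by omega, pow_succ']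

end Sorting

section Eulerian

open MvPolynomial

/-- The operator `f ↦ (s + t) f + s t (∂/∂s + ∂/∂t) f`. -/
noncomputable def eulerOp : MvPolynomial (Fin 2) ℚ →ₗ[ℚ] MvPolynomial (Fin 2) ℚ :=
  LinearMap.mulLeft ℚ (X 0 + X 1) + LinearMap.mulLeft ℚ (X 0 * X 1) ∘ₗ
    ((pderiv 0 : Derivation ℚ _ _).toLinearMap + (pderiv 1 : Derivation ℚ _ _).toLinearMap)

lemma eulerOp_apply (f : MvPolynomial (Fin 2) ℚ) :
    eulerOp f = (X 0 + X 1) * f + X 0 * X 1 * (pderiv 0 f + pderiv 1 f) := rfl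

lemma eulerOp_monomial (d a : ℕ) :
    eulerOp (X 1 ^ d * X 0 ^ a)
      = ((d + 1 : ℕ) : ℚ) • (X 1 ^ d * X 0 ^ (a + 1))
        + ((a + 1 : ℕ) : ℚ) • (X 1 ^ (d + 1) * X 0 ^ a) := by
  rw [eulerOp_apply, smul_eq_C_mul, smul_eq_C_mul]
  simp only [map_natCast]
  rcases d with _ | d <;> rcases a with _ | a <;>
    simp [Derivation.leibniz, Derivation.leibniz_pow, pderiv_X] <;> ring

/-- The functional sending `s ^ a * t ^ d` to `(k + a).choose n`. -/
noncomputable def chooseFunctional (n k : ℕ) : MvPolynomial (Fin 2) ℚ →ₗ[ℚ] ℚ :=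
  (basisMonomials (Fin 2) ℚ).constr ℚ fun m => ((k + m 0).choose n : ℚ)

lemma chooseFunctional_monomial (n k d a : ℕ) :
    chooseFunctional n k (X 1 ^ d * X 0 ^ a) = ((k + a).choose n : ℚ) := by
  have h : (X 1 ^ d * X 0 ^ a : MvPolynomial (Fin 2) ℚ)
      = basisMonomials (Fin 2) ℚ (Finsupp.single 1 d + Finsupp.single 0 a) := by
    rw [coe_basisMonomials, X_pow_eq_monomial, X_pow_eq_monomial, monomial_mul, one_mul]
  rw [h, chooseFunctional, Module.Basis.constr_basis]
  simp

lemma worpitzky (n k d a : ℕ) (h : a + d = n) :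
    (d + 1 : ℕ) * ((k + (a + 1)).choose (n + 2) : ℚ) + (a + 1 : ℕ) * ((k + a).choose (n + 2) : ℚ)
      = k * ((k + a).choose (n + 1) : ℚ) := by
  rw [← add_assoc, Nat.choose_succ_succ]
  have h1 : ((k + a).choose (n + 2) : ℚ) * (n + 2)
      = ((k + a).choose (n + 1) : ℚ) * (k + a - (n + 1)) := by
    rcases le_or_gt (n + 1) (k + a) with h2 | h2
    · have := Nat.choose_succ_right_eq (k + a) (n + 1)
      have h3 : (((k + a).choose (n + 2) * (n + 2) : ℕ) : ℚ)
          = (((k + a).choose (n + 1) * (k + a - (n + 1)) : ℕ) : ℚ) := by exact_mod_cast this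
      push_cast [Nat.cast_sub h2] at h3
      exact h3
    · rw [Nat.choose_eq_zero_of_lt h2, Nat.choose_eq_zero_of_lt (by omega)]
      simp
  subst h
  push_cast at h1 ⊢
  linear_combination h1

lemma chooseFunctional_eulerOp (n k d a : ℕ) (h : a + d = n) :
    chooseFunctional (n + 2) k (eulerOp (X 1 ^ d * X 0 ^ a))
      = k * chooseFunctional (n + 1) k (X 1 ^ d * X 0 ^ a) := by
  simp only [eulerOp_monomial, map_add, map_smul, chooseFunctional_monomial, smul_eq_mul]
  exact worpitzky n k d a h

lemma chooseFunctional_sub_mul (n k d a : ℕ) :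
    chooseFunctional (n + 1) k ((X 0 - X 1) * (X 1 ^ d * X 0 ^ a))
      = chooseFunctional n k (X 1 ^ d * X 0 ^ a) := by
  have h : ((X 0 - X 1) * (X 1 ^ d * X 0 ^ a) : MvPolynomial (Fin 2) ℚ)
      = X 1 ^ d * X 0 ^ (a + 1) - X 1 ^ (d + 1) * X 0 ^ a := by ring
  rw [h, map_sub]
  simp only [chooseFunctional_monomial, ← add_assoc, Nat.choose_succ_succ]
  push_cast
  ring

/-- The span of the monomials of degree `n`. -/
noncomputable def homogeneousSpan (n : ℕ) : Submodule ℚ (MvPolynomial (Fin 2) ℚ) :=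
  Submodule.span ℚ {f | ∃ d a, a + d = n ∧ f = X 1 ^ d * X 0 ^ a}

lemma monomial_mem_homogeneousSpan {n d a : ℕ} (h : a + d = n) :
    (X 1 ^ d * X 0 ^ a : MvPolynomial (Fin 2) ℚ) ∈ homogeneousSpan n :=
  Submodule.subset_span ⟨d, a, h, rfl⟩

lemma exists_coeff_of_mem_homogeneousSpan {n : ℕ} {f : MvPolynomial (Fin 2) ℚ}
    (hf : f ∈ homogeneousSpan n) :
    ∃ c : ℕ → ℚ, f = ∑ d ∈ range (n + 1), c d • (X 1 ^ d * X 0 ^ (n - d)) := by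
  induction hf using Submodule.span_induction with
  | mem f hf =>
    obtain ⟨d, a, h, rfl⟩ := hf
    refine ⟨Pi.single d 1, ?_⟩
    rw [sum_eq_single d]
    · rw [Pi.single_eq_same, one_smul, show n - d = a by omega]
    · intro e _ he
      rw [Pi.single_eq_of_ne he, zero_smul]
    · intro hd
      exact absurd (mem_range.2 (by omega)) hd
  | zero => exact ⟨0, by simp⟩
  | add f g _ _ hf hg =>
    obtain ⟨c, rfl⟩ := hf
    obtain ⟨e, rfl⟩ := hg
    exact ⟨c + e, by simp [add_smul, sum_add_distrib]⟩
  | smul r f _ hf =>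
    obtain ⟨c, rfl⟩ := hf
    exact ⟨r • c, by simp only [smul_sum, smul_smul, Pi.smul_apply, smul_eq_mul]⟩

lemma eq_of_chooseFunctional_eq {n : ℕ} {f g : MvPolynomial (Fin 2) ℚ}
    (hf : f ∈ homogeneousSpan n) (hg : g ∈ homogeneousSpan n)
    (h : ∀ k, chooseFunctional (n + 1) k f = chooseFunctional (n + 1) k g) : f = g := by
  rw [← sub_eq_zero]
  obtain ⟨c, hc⟩ := exists_coeff_of_mem_homogeneousSpan (sub_mem hf hg)
  have h0 : ∀ k, ∑ d ∈ range (n + 1), c d * ((k + (n - d)).choose (n + 1) : ℚ) = 0 := by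
    intro k
    have := sub_eq_zero.2 (h k)
    rw [← map_sub, hc, map_sum] at this
    simpa only [map_smul, chooseFunctional_monomial, smul_eq_mul] using this
  have hz : ∀ d, d < n + 1 → c d = 0 := by
    intro d
    induction d using Nat.strong_induction_on with
    | _ d ih =>
      intro hd
      have := h0 (d + 1)
      rw [sum_eq_single d] at this
      · rw [show d + 1 + (n - d) = n + 1 by omega, Nat.choose_self] at this
        simpa using this
      · intro e he hed
        rcases lt_or_gt_of_ne hed with h1 | h1
        · rw [ih e h1 (mem_range.1 he), zero_mul]
        · rw [Nat.choose_eq_zero_of_lt (by have := mem_range.1 he; omega)]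
          simp
      · intro h1
        exact absurd (mem_range.2 hd) h1
  rw [hc]
  refine sum_eq_zero fun d hd => ?_
  rw [hz d (mem_range.1 hd), zero_smul]

lemma ascA_add_desA {m : ℕ} (π : Equiv.Perm (Fin (m + 1))) : ascA π + desA π = m := by
  unfold ascA desA
  rw [← card_union_of_disjoint, ← filter_or, filter_true_of_mem, card_univ]
  · simp
  · intro i _
    refine lt_or_gt_of_ne fun h => ?_
    have := π.injective h
    simp [Fin.ext_iff] at this
  · rw [disjoint_filter]
    intro i _ h1 h2
    exact lt_asymm h1 h2

/-- The weighted bivariate Eulerian polynomial. -/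
noncomputable def weightedEulerian {n : ℕ} (w : Equiv.Perm (Fin n) → ℚ) :
    MvPolynomial (Fin 2) ℚ :=
  ∑ π, w π • (X 1 ^ desA π * X 0 ^ ascA π)

lemma chooseFunctional_weightedEulerian {m : ℕ} (k : ℕ) (w : Equiv.Perm (Fin (m + 1)) → ℚ) :
    chooseFunctional (m + 1) k (weightedEulerian w)
      = ∑ f : Fin (m + 1) → Fin k, w (Tuple.sort f) := by
  rw [← sum_mul_choose_eq_sum_sort, weightedEulerian, map_sum]
  simp only [map_smul, chooseFunctional_monomial, smul_eq_mul]

lemma weightedEulerian_mem {m : ℕ} (w : Equiv.Perm (Fin (m + 1)) → ℚ) :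
    weightedEulerian w ∈ homogeneousSpan m :=
  sum_mem fun π _ => Submodule.smul_mem _ _ (monomial_mem_homogeneousSpan (ascA_add_desA π))

lemma weightedEulerian_eq_eulerOp {m : ℕ} (w : Equiv.Perm (Fin (m + 1)) → ℚ)
    (w' : Equiv.Perm (Fin (m + 2)) → ℚ)
    (h : ∀ k : ℕ, ∑ f : Fin (m + 2) → Fin k, w' (Tuple.sort f)
      = k * ∑ f : Fin (m + 1) → Fin k, w (Tuple.sort f)) :
    weightedEulerian w' = eulerOp (weightedEulerian w) := by
  refine eq_of_chooseFunctional_eq (weightedEulerian_mem w') ?_ fun k => ?_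
  · rw [weightedEulerian, map_sum]
    refine sum_mem fun π _ => ?_
    rw [map_smul, eulerOp_monomial]
    have := ascA_add_desA π
    exact Submodule.smul_mem _ _ (add_mem
      (Submodule.smul_mem _ _ (monomial_mem_homogeneousSpan (by omega)))
      (Submodule.smul_mem _ _ (monomial_mem_homogeneousSpan (by omega))))
  · rw [chooseFunctional_weightedEulerian, h, ← chooseFunctional_weightedEulerian]
    simp only [weightedEulerian, map_sum, map_smul, mul_sum]
    refine sum_congr rfl fun π _ => ?_
    rw [chooseFunctional_eulerOp _ _ _ _ (ascA_add_desA π), smul_eq_mul, smul_eq_mul]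
    ring

lemma weightedEulerian_eq_sub_mul {m : ℕ} (w : Equiv.Perm (Fin (m + 1)) → ℚ)
    (w' : Equiv.Perm (Fin (m + 2)) → ℚ)
    (h : ∀ k : ℕ, ∑ f : Fin (m + 2) → Fin k, w' (Tuple.sort f)
      = ∑ f : Fin (m + 1) → Fin k, w (Tuple.sort f)) :
    weightedEulerian w' = (X 0 - X 1) * weightedEulerian w := by
  refine eq_of_chooseFunctional_eq (weightedEulerian_mem w') ?_ fun k => ?_
  · rw [weightedEulerian, mul_sum]
    refine sum_mem fun π _ => ?_
    have := ascA_add_desA π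
    rw [mul_smul_comm]
    refine Submodule.smul_mem _ _ ?_
    have h1 : ((X 0 - X 1) * (X 1 ^ desA π * X 0 ^ ascA π) : MvPolynomial (Fin 2) ℚ)
      = X 1 ^ desA π * X 0 ^ (ascA π + 1) - X 1 ^ (desA π + 1) * X 0 ^ ascA π := by ring
    rw [h1]
    exact sub_mem (monomial_mem_homogeneousSpan (by omega))
      (monomial_mem_homogeneousSpan (by omega))
  · rw [chooseFunctional_weightedEulerian, h, ← chooseFunctional_weightedEulerian]
    simp only [weightedEulerian, mul_sum, map_sum, map_smul, mul_smul_comm,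
      chooseFunctional_sub_mul]

/-- The signed Eulerian polynomial. -/
noncomputable def signedEulerian (n : ℕ) : MvPolynomial (Fin 2) ℚ :=
  weightedEulerian fun π : Equiv.Perm (Fin n) => ((Equiv.Perm.sign π : ℤ) : ℚ)

lemma Abiv_eq_weightedEulerian (n : ℕ) :
    Abiv n = weightedEulerian fun _ : Equiv.Perm (Fin n) => 1 := by
  simp [Abiv, weightedEulerian]

lemma Abiv_succ (m : ℕ) : Abiv (m + 2) = eulerOp (Abiv (m + 1)) := by
  rw [Abiv_eq_weightedEulerian, Abiv_eq_weightedEulerian]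
  refine weightedEulerian_eq_eulerOp _ _ fun k => ?_
  simp
  ring

lemma signedEulerian_of_even {m : ℕ} (hm : Even m) :
    signedEulerian (m + 2) = (X 0 - X 1) * signedEulerian (m + 1) := by
  refine weightedEulerian_eq_sub_mul _ _ fun k => ?_
  simp only [sign_sort, sum_wordSign]
  rw [show (m + 2 + 1) / 2 = (m + 1 + 1) / 2 by obtain ⟨r, rfl⟩ := hm; omega]

lemma signedEulerian_of_odd {m : ℕ} (hm : Odd m) :
    signedEulerian (m + 2) = eulerOp (signedEulerian (m + 1)) := by
  refine weightedEulerian_eq_eulerOp _ _ fun k => ?_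
  simp only [sign_sort, sum_wordSign]
  rw [show (m + 2 + 1) / 2 = (m + 1 + 1) / 2 + 1 by obtain ⟨r, rfl⟩ := hm; omega, pow_succ']

lemma AbivP_add_AbivM (n : ℕ) : AbivP n + AbivM n = Abiv n := by
  rw [AbivP, AbivM, Abiv, ← sum_filter_add_sum_filter_not univ
    (fun π : Equiv.Perm (Fin n) => Equiv.Perm.sign π = 1)]
  congr 2
  ext π
  rcases Int.units_eq_one_or (Equiv.Perm.sign π) with h | h <;> simp [h]

lemma AbivP_sub_AbivM (n : ℕ) : AbivP n - AbivM n = signedEulerian n := by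
  rw [AbivP, AbivM, signedEulerian, weightedEulerian, sum_filter, sum_filter,
    ← sum_sub_distrib]
  refine sum_congr rfl fun π _ => ?_
  rcases Int.units_eq_one_or (Equiv.Perm.sign π) with h | h <;> simp [h]

end Eulerian

section GammaCone

open MvPolynomial

/-- The polynomial `s + t`. -/
noncomputable def gammaU : MvPolynomial (Fin 2) ℚ := X 0 + X 1

/-- The polynomial `s t`. -/
noncomputable def gammaV : MvPolynomial (Fin 2) ℚ := X 0 * X 1

lemma sub_sq_eq : (X 0 - X 1 : MvPolynomial (Fin 2) ℚ) ^ 2 = gammaU ^ 2 - 4 * gammaV := by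
  rw [gammaU, gammaV]
  ring

/-- The monoid of gamma positive polynomials with centre of symmetry `N / 2`. -/
noncomputable def gammaCone (N : ℕ) : AddSubmonoid (MvPolynomial (Fin 2) ℚ) :=
  AddSubmonoid.closure {f | ∃ i j, 2 * i + j = N ∧ f = gammaV ^ i * gammaU ^ j}

lemma natCast_mul_mem_gammaCone {N i j : ℕ} (c : ℕ) (h : 2 * i + j = N) :
    (c : MvPolynomial (Fin 2) ℚ) * (gammaV ^ i * gammaU ^ j) ∈ gammaCone N := by
  rw [← nsmul_eq_mul]
  exact nsmul_mem (AddSubmonoid.subset_closure (by exact ⟨i, j, h, rfl⟩)) c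

lemma BivGamma_of_mem_gammaCone {N : ℕ} {f : MvPolynomial (Fin 2) ℚ} (hf : f ∈ gammaCone N) :
    BivGamma f N := by
  induction hf using AddSubmonoid.closure_induction with
  | mem f hf =>
    obtain ⟨i, j, h, rfl⟩ := hf
    refine ⟨Pi.single i 1, fun e he => ?_, ?_⟩
    · rcases eq_or_ne e i with rfl | h1
      · omega
      · exact absurd (Pi.single_eq_of_ne h1 1) he
    · rw [sum_eq_single i]
      · rw [Pi.single_eq_same, Nat.cast_one, one_mul, show N - 2 * i = j by omega, gammaU, gammaV]
      · intro e _ he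
        rw [Pi.single_eq_of_ne he, Nat.cast_zero, zero_mul]
      · intro hi
        exact absurd (mem_range.2 (by omega)) hi
  | zero => exact ⟨0, by simp, by simp⟩
  | add f g _ _ hf hg =>
    obtain ⟨γ, hγ, rfl⟩ := hf
    obtain ⟨δ, hδ, rfl⟩ := hg
    refine ⟨γ + δ, fun i hi => ?_, by simp [add_mul, sum_add_distrib]⟩
    by_cases h : γ i = 0
    · exact hδ i (by simpa [h] using hi)
    · exact hγ i h

lemma eulerOp_natCast_mul (c : ℕ) (f : MvPolynomial (Fin 2) ℚ) :
    eulerOp (c * f) = c * eulerOp f := by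
  rw [← nsmul_eq_mul, map_nsmul, nsmul_eq_mul]

lemma eulerOp_sub_mul (f : MvPolynomial (Fin 2) ℚ) :
    eulerOp ((X 0 - X 1) * f) = (X 0 - X 1) * eulerOp f := by
  simp only [eulerOp_apply, Derivation.leibniz, map_sub, pderiv_X, smul_eq_mul]
  simp
  ring

lemma eulerOp_gamma_zero (i : ℕ) :
    eulerOp (gammaV ^ i * gammaU ^ 0) = (i + 1 : ℕ) * (gammaV ^ i * gammaU ^ 1) := by
  rw [eulerOp_apply, gammaU, gammaV]
  rcases i with _ | i
  · simp
  · simp [Derivation.leibniz, Derivation.leibniz_pow, pderiv_X]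
    ring

lemma eulerOp_gamma_succ (i j : ℕ) :
    eulerOp (gammaV ^ i * gammaU ^ (j + 1)) = (i + 1 : ℕ) * (gammaV ^ i * gammaU ^ (j + 2))
      + (2 * (j + 1) : ℕ) * (gammaV ^ (i + 1) * gammaU ^ j) := by
  have hu0 : pderiv 0 gammaU = 1 := by simp [gammaU, pderiv_X]
  have hu1 : pderiv 1 gammaU = 1 := by simp [gammaU, pderiv_X]
  have hv : pderiv 0 gammaV + pderiv 1 gammaV = gammaU := by
    simp [gammaU, gammaV, pderiv_X, add_comm]
  rw [eulerOp_apply]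
  simp only [Derivation.leibniz, Derivation.leibniz_pow, hu0, hu1, smul_eq_mul, nsmul_eq_mul]
  change gammaU * _ + gammaV * _ = _
  rcases i with _ | i
  · push_cast
    ring
  · push_cast
    linear_combination gammaV * (gammaU ^ (j + 1) * ((i + 1) * gammaV ^ i)) * hv

lemma eulerOp_mem_gammaCone {N : ℕ} {f : MvPolynomial (Fin 2) ℚ} (hf : f ∈ gammaCone N) :
    eulerOp f ∈ gammaCone (N + 1) := by
  induction hf using AddSubmonoid.closure_induction with
  | mem f hf =>
    obtain ⟨i, j, h, rfl⟩ := hf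
    rcases j with _ | j
    · rw [eulerOp_gamma_zero]
      exact natCast_mul_mem_gammaCone _ (by omega)
    · rw [eulerOp_gamma_succ]
      exact add_mem (natCast_mul_mem_gammaCone _ (by omega))
        (natCast_mul_mem_gammaCone _ (by omega))
  | zero => rw [map_zero]; exact zero_mem _
  | add f g _ _ hf hg => rw [map_add]; exact add_mem hf hg

lemma exists_half_add (i : ℕ) : ∃ p : ℕ, (i + 1) * (i ^ 2 + 2 * i + 2) = 2 * p := by
  rcases Nat.even_or_odd' i with ⟨a, rfl | rfl⟩
  · exact ⟨(2 * a + 1) * (2 * a ^ 2 + 2 * a + 1), by ring⟩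
  · exact ⟨(a + 1) * ((2 * a + 1) ^ 2 + 2 * (2 * a + 1) + 2), by ring⟩

lemma exists_half_sub (i : ℕ) : ∃ p : ℕ, (i + 1) * (i ^ 2 + 2 * i) = 2 * p := by
  rcases Nat.even_or_odd' i with ⟨a, rfl | rfl⟩
  · exact ⟨(2 * a + 1) * (2 * a ^ 2 + 2 * a), by ring⟩
  · exact ⟨(a + 1) * ((2 * a + 1) ^ 2 + 2 * (2 * a + 1)), by ring⟩

lemma exists_half_gamma_add (i j : ℕ) : ∃ g ∈ gammaCone (2 * i + j + 3),
    eulerOp (eulerOp (eulerOp (gammaV ^ i * gammaU ^ j)))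
      + (X 0 - X 1) ^ 2 * eulerOp (gammaV ^ i * gammaU ^ j) = 2 * g := by
  obtain ⟨p, hp⟩ := exists_half_add i
  have hp' : ((i : MvPolynomial (Fin 2) ℚ) + 1) * (i ^ 2 + 2 * i + 2) = 2 * p := by
    exact_mod_cast congrArg (Nat.cast : ℕ → MvPolynomial (Fin 2) ℚ) hp
  rw [sub_sq_eq]
  have h0 := natCast_mul_mem_gammaCone (N := 2 * i + j + 3) (i := i) (j := j + 3) p (by omega)
  have h1 := natCast_mul_mem_gammaCone (N := 2 * i + j + 3) (i := i + 1) (j := j + 1)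
    ((i + 1) * (2 * i * j + 3 * i + 3 * j + 2) + j * ((i + 2) ^ 2 + 1)) (by omega)
  rcases j with _ | j
  · refine ⟨_, add_mem h0 h1, ?_⟩
    simp only [map_add, eulerOp_natCast_mul, eulerOp_gamma_zero, eulerOp_gamma_succ, zero_add]
    push_cast
    linear_combination hp' * (gammaV ^ i * gammaU ^ 3)
  have h2 := natCast_mul_mem_gammaCone (N := 2 * i + (j + 1) + 3) (i := i + 2) (j := j)
    (2 * (i + 1) * (j + 2) * (j + 1) + 2 * (j + 1) * (2 * i * j + 5 * j + i)) (by omega)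
  rcases j with _ | _ | j
  · refine ⟨_, add_mem (add_mem h0 h1) h2, ?_⟩
    simp only [map_add, eulerOp_natCast_mul, eulerOp_gamma_zero, eulerOp_gamma_succ, zero_add,
      eulerOp_gamma_succ _ 0]
    push_cast
    linear_combination hp' * (gammaV ^ i * gammaU ^ 4)
  · refine ⟨_, add_mem (add_mem h0 h1) h2, ?_⟩
    simp only [map_add, eulerOp_natCast_mul, eulerOp_gamma_zero, eulerOp_gamma_succ, zero_add]
    push_cast
    linear_combination hp' * (gammaV ^ i * gammaU ^ 5)
  · have h3 := natCast_mul_mem_gammaCone (N := 2 * i + (j + 2 + 1) + 3) (i := i + 3) (j := j)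
      (4 * (j + 3) * (j + 2) * (j + 1)) (by omega)
    refine ⟨_, add_mem (add_mem (add_mem h0 h1) h2) h3, ?_⟩
    simp only [map_add, eulerOp_natCast_mul, eulerOp_gamma_succ]
    push_cast
    linear_combination hp' * (gammaV ^ i * gammaU ^ (j + 6))

lemma exists_half_gamma_sub (i j : ℕ) : ∃ g ∈ gammaCone (2 * i + j + 3),
    eulerOp (eulerOp (eulerOp (gammaV ^ i * gammaU ^ j)))
      - (X 0 - X 1) ^ 2 * eulerOp (gammaV ^ i * gammaU ^ j) = 2 * g := by
  obtain ⟨p, hp⟩ := exists_half_sub i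
  have hp' : ((i : MvPolynomial (Fin 2) ℚ) + 1) * (i ^ 2 + 2 * i) = 2 * p := by
    exact_mod_cast congrArg (Nat.cast : ℕ → MvPolynomial (Fin 2) ℚ) hp
  rw [sub_sq_eq]
  have h0 := natCast_mul_mem_gammaCone (N := 2 * i + j + 3) (i := i) (j := j + 3) p (by omega)
  have h1 := natCast_mul_mem_gammaCone (N := 2 * i + j + 3) (i := i + 1) (j := j + 1)
    ((i + 1) * (2 * i * j + 3 * i + 3 * j + 6) + j * (i ^ 2 + 4 * i + 3)) (by omega)
  rcases j with _ | j
  · refine ⟨_, add_mem h0 h1, ?_⟩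
    simp only [map_add, eulerOp_natCast_mul, eulerOp_gamma_zero, eulerOp_gamma_succ, zero_add]
    push_cast
    linear_combination hp' * (gammaV ^ i * gammaU ^ 3)
  have h2 := natCast_mul_mem_gammaCone (N := 2 * i + (j + 1) + 3) (i := i + 2) (j := j)
    (2 * (i + 1) * (j + 2) * (j + 1) + 2 * (j + 1) * (2 * i * j + 5 * j + i + 4)) (by omega)
  rcases j with _ | _ | j
  · refine ⟨_, add_mem (add_mem h0 h1) h2, ?_⟩
    simp only [map_add, eulerOp_natCast_mul, eulerOp_gamma_zero, eulerOp_gamma_succ, zero_add,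
      eulerOp_gamma_succ _ 0]
    push_cast
    linear_combination hp' * (gammaV ^ i * gammaU ^ 4)
  · refine ⟨_, add_mem (add_mem h0 h1) h2, ?_⟩
    simp only [map_add, eulerOp_natCast_mul, eulerOp_gamma_zero, eulerOp_gamma_succ, zero_add]
    push_cast
    linear_combination hp' * (gammaV ^ i * gammaU ^ 5)
  · have h3 := natCast_mul_mem_gammaCone (N := 2 * i + (j + 2 + 1) + 3) (i := i + 3) (j := j)
      (4 * (j + 3) * (j + 2) * (j + 1)) (by omega)
    refine ⟨_, add_mem (add_mem (add_mem h0 h1) h2) h3, ?_⟩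
    simp only [map_add, eulerOp_natCast_mul, eulerOp_gamma_succ]
    push_cast
    linear_combination hp' * (gammaV ^ i * gammaU ^ (j + 6))

lemma exists_half_add_of_mem_gammaCone {N : ℕ} {f : MvPolynomial (Fin 2) ℚ}
    (hf : f ∈ gammaCone N) : ∃ g ∈ gammaCone (N + 3),
      eulerOp (eulerOp (eulerOp f)) + (X 0 - X 1) ^ 2 * eulerOp f = 2 * g := by
  induction hf using AddSubmonoid.closure_induction with
  | mem f hf =>
    obtain ⟨i, j, rfl, rfl⟩ := hf
    exact exists_half_gamma_add i j
  | zero => exact ⟨0, zero_mem _, by simp⟩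
  | add f g _ _ hf hg =>
    obtain ⟨a, ha, hfa⟩ := hf
    obtain ⟨b, hb, hgb⟩ := hg
    refine ⟨a + b, add_mem ha hb, ?_⟩
    simp only [map_add]
    linear_combination hfa + hgb

lemma exists_half_sub_of_mem_gammaCone {N : ℕ} {f : MvPolynomial (Fin 2) ℚ}
    (hf : f ∈ gammaCone N) : ∃ g ∈ gammaCone (N + 3),
      eulerOp (eulerOp (eulerOp f)) - (X 0 - X 1) ^ 2 * eulerOp f = 2 * g := by
  induction hf using AddSubmonoid.closure_induction with
  | mem f hf =>
    obtain ⟨i, j, rfl, rfl⟩ := hf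
    exact exists_half_gamma_sub i j
  | zero => exact ⟨0, zero_mem _, by simp⟩
  | add f g _ _ hf hg =>
    obtain ⟨a, ha, hfa⟩ := hf
    obtain ⟨b, hb, hgb⟩ := hg
    refine ⟨a + b, add_mem ha hb, ?_⟩
    simp only [map_add]
    linear_combination hfa + hgb

lemma AbivP_AbivM_mem_gammaCone_add_three {m : ℕ} (hm : Even m)
    (hP : AbivP (m + 1) ∈ gammaCone m) (hM : AbivM (m + 1) ∈ gammaCone m) :
    AbivP (m + 4) ∈ gammaCone (m + 3) ∧ AbivM (m + 4) ∈ gammaCone (m + 3) := by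
  have hA : AbivP (m + 4) + AbivM (m + 4)
      = eulerOp (eulerOp (eulerOp (AbivP (m + 1) + AbivM (m + 1)))) := by
    rw [AbivP_add_AbivM, AbivP_add_AbivM, Abiv_succ (m + 2), Abiv_succ (m + 1), Abiv_succ m]
  have hS : AbivP (m + 4) - AbivM (m + 4)
      = (X 0 - X 1) ^ 2 * eulerOp (AbivP (m + 1) - AbivM (m + 1)) := by
    have h4 := signedEulerian_of_even (m := m + 2) (hm.add even_two)
    have h3 : signedEulerian (m + 2 + 1) = eulerOp (signedEulerian (m + 2)) :=
      signedEulerian_of_odd hm.add_one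
    rw [AbivP_sub_AbivM, AbivP_sub_AbivM, h4, h3, signedEulerian_of_even hm, eulerOp_sub_mul]
    ring
  obtain ⟨a, ha, hPa⟩ := exists_half_add_of_mem_gammaCone hP
  obtain ⟨b, hb, hMb⟩ := exists_half_sub_of_mem_gammaCone hM
  obtain ⟨c, hc, hPc⟩ := exists_half_sub_of_mem_gammaCone hP
  obtain ⟨d, hd, hMd⟩ := exists_half_add_of_mem_gammaCone hM
  simp only [map_add, map_sub] at hA hS
  have h2 : (2 : MvPolynomial (Fin 2) ℚ) ≠ 0 := two_ne_zero
  have h1 : AbivP (m + 4) = a + b :=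
    mul_left_cancel₀ h2 (by linear_combination hA + hS + hPa + hMb)
  have h3 : AbivM (m + 4) = c + d :=
    mul_left_cancel₀ h2 (by linear_combination hA - hS + hPc + hMd)
  exact ⟨h1 ▸ add_mem ha hb, h3 ▸ add_mem hc hd⟩

lemma AbivP_AbivM_mem_gammaCone_succ {m : ℕ} (hm : Odd m)
    (h : AbivP (m + 1) ∈ gammaCone m ∧ AbivM (m + 1) ∈ gammaCone m) :
    AbivP (m + 2) ∈ gammaCone (m + 1) ∧ AbivM (m + 2) ∈ gammaCone (m + 1) := by
  have hA : AbivP (m + 2) + AbivM (m + 2) = eulerOp (AbivP (m + 1) + AbivM (m + 1)) := by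
    rw [AbivP_add_AbivM, AbivP_add_AbivM, Abiv_succ]
  have hS : AbivP (m + 2) - AbivM (m + 2) = eulerOp (AbivP (m + 1) - AbivM (m + 1)) := by
    rw [AbivP_sub_AbivM, AbivP_sub_AbivM, signedEulerian_of_odd hm]
  rw [map_add] at hA
  rw [map_sub] at hS
  have h2 : (2 : MvPolynomial (Fin 2) ℚ) ≠ 0 := two_ne_zero
  have h1 : AbivP (m + 2) = eulerOp (AbivP (m + 1)) :=
    mul_left_cancel₀ h2 (by linear_combination hA + hS)
  have h3 : AbivM (m + 2) = eulerOp (AbivM (m + 1)) :=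
    mul_left_cancel₀ h2 (by linear_combination hA - hS)
  exact ⟨h1 ▸ eulerOp_mem_gammaCone h.1, h3 ▸ eulerOp_mem_gammaCone h.2⟩

lemma AbivP_AbivM_mem_gammaCone (q : ℕ) :
    AbivP (4 * q + 1) ∈ gammaCone (4 * q) ∧ AbivM (4 * q + 1) ∈ gammaCone (4 * q) := by
  induction q with
  | zero =>
    have hP : AbivP (4 * 0 + 1) = gammaV ^ 0 * gammaU ^ 0 := by
      change AbivP 1 = _
      have h : univ.filter (fun π : Equiv.Perm (Fin 1) => Equiv.Perm.sign π = 1) = {1} := by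
        decide
      rw [AbivP, h, sum_singleton]
      simp [desA, ascA]
    have hM : AbivM (4 * 0 + 1) = 0 := by
      change AbivM 1 = _
      have h : univ.filter (fun π : Equiv.Perm (Fin 1) => Equiv.Perm.sign π = -1) = ∅ := by
        decide
      rw [AbivM, h, sum_empty]
    rw [hP, hM]
    exact ⟨AddSubmonoid.subset_closure (by exact ⟨0, 0, rfl, rfl⟩), zero_mem _⟩
  | succ q ih =>
    have hm : Even (4 * q) := ⟨2 * q, by ring⟩
    exact AbivP_AbivM_mem_gammaCone_succ (m := 4 * q + 3) ⟨2 * q + 1, by ring⟩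
      (AbivP_AbivM_mem_gammaCone_add_three hm ih.1 ih.2)

end GammaCone

theorem AbivP_AbivM_gamma_positive (n : ℕ) (hn : 4 ≤ n) (h4 : n % 4 = 0 ∨ n % 4 = 1) :
    BivGamma (AbivP n) (n-1) ∧ BivGamma (AbivM n) (n-1) := by
  rcases h4 with h4 | h4
  · obtain ⟨q, rfl⟩ : ∃ q, n = 4 * q + 4 := ⟨n / 4 - 1, by omega⟩
    have ih := AbivP_AbivM_mem_gammaCone q
    have h := AbivP_AbivM_mem_gammaCone_add_three ⟨2 * q, by ring⟩ ih.1 ih.2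
    exact ⟨BivGamma_of_mem_gammaCone h.1, BivGamma_of_mem_gammaCone h.2⟩
  · obtain ⟨q, rfl⟩ : ∃ q, n = 4 * q + 1 := ⟨n / 4, by omega⟩
    have h := AbivP_AbivM_mem_gammaCone q
    exact ⟨BivGamma_of_mem_gammaCone h.1, BivGamma_of_mem_gammaCone h.2⟩
end
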